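/- arXiv:1811.10539 — 5 statements merged into one kernel-verified Lean document; each statement's English description precedes it below -/
import Mathlib

section
/- Let n > 1 be an integer and let K be a field whose characteristic is zero or coprime to n(n-1). Fix elements a_2, …, a_{n-2} ∈ K, regard a_{n-1} and a_n as indeterminates, and work in the polynomial ring R = K[a_{n-1}, a_n]. Let f(x) = x^n + a_2 x^{n-2} + ⋯ + a_{n-2} x^2 + a_{n-1} x + a_n ∈ R[x] and let Δ = disc(f) ∈ R be its discriminant. Then Δ is irreducible in R = K[a_{n-1}, a_n]. -/
open Polynomial

/-- The Sylvester matrix of two polynomials `p`, `q`, of size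
`(p.natDegree + q.natDegree) × (p.natDegree + q.natDegree)`:
the first `q.natDegree` rows contain the shifted coefficients of `p`,
the remaining `p.natDegree` rows the shifted coefficients of `q`. -/
noncomputable def sylvesterMatrix {R : Type*} [CommRing R] (p q : R[X]) :
    Matrix (Fin (p.natDegree + q.natDegree)) (Fin (p.natDegree + q.natDegree)) R :=
  Matrix.of fun i j =>
    if (i : ℕ) < q.natDegree then
      if (i : ℕ) ≤ (j : ℕ) ∧ (j : ℕ) ≤ (i : ℕ) + p.natDegree then
        p.coeff (p.natDegree + i - j)
      else 0
    else
      if (i : ℕ) - q.natDegree ≤ (j : ℕ) ∧ (j : ℕ) ≤ (i : ℕ) then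
        q.coeff (q.natDegree + ((i : ℕ) - q.natDegree) - j)
      else 0

/-- The resultant `Res(p, q)` of two polynomials, as the determinant of their
Sylvester matrix. -/
noncomputable def polyRes {R : Type*} [CommRing R] (p q : R[X]) : R :=
  (sylvesterMatrix p q).det

/-- The discriminant of a (monic) polynomial `f` of degree `N`:
`disc f = (-1) ^ (N * (N - 1) / 2) * Res (f, f')`. -/
noncomputable def polyDisc {R : Type*} [CommRing R] (f : R[X]) : R :=
  (-1) ^ (f.natDegree * (f.natDegree - 1) / 2) * polyRes f (derivative f)

namespace DiscriminantIrreducible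

/-- The Sylvester matrix of `p` and `q` with prescribed formal degrees `m` and `k`. -/
def formalSylvester {R : Type*} [CommRing R] (p q : R[X]) (m k : ℕ) :
    Matrix (Fin (m + k)) (Fin (m + k)) R :=
  Matrix.of fun i j =>
    if (i : ℕ) < k then
      if (i : ℕ) ≤ (j : ℕ) ∧ (j : ℕ) ≤ (i : ℕ) + m then p.coeff (m + i - j) else 0
    else
      if (i : ℕ) - k ≤ (j : ℕ) ∧ (j : ℕ) ≤ (i : ℕ) then q.coeff (k + ((i : ℕ) - k) - j) else 0

theorem polyRes_eq_det_formalSylvester {R : Type*} [CommRing R] {p q : R[X]} {m k : ℕ}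
    (hp : p.natDegree = m) (hq : q.natDegree = k) :
    polyRes p q = (formalSylvester p q m k).det := by
  subst hp hq
  rfl

theorem formalSylvester_map {R S : Type*} [CommRing R] [CommRing S] (φ : R →+* S) (p q : R[X])
    (m k : ℕ) :
    formalSylvester (p.map φ) (q.map φ) m k = (formalSylvester p q m k).map φ := by
  ext i j
  simp only [formalSylvester, Matrix.of_apply, Matrix.map_apply, coeff_map]
  split_ifs <;> simp

theorem det_formalSylvester_map {R S : Type*} [CommRing R] [CommRing S] (φ : R →+* S) (p q : R[X])
    (m k : ℕ) :
    (formalSylvester (p.map φ) (q.map φ) m k).det = φ (formalSylvester p q m k).det := by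
  rw [formalSylvester_map, RingHom.map_det]
  rfl

/-- Summing a window of coefficients against decreasing powers of `x` evaluates the polynomial. -/
theorem sum_window_coeff_mul_pow {R : Type*} [CommRing R] {p : R[X]} {m N l : ℕ}
    (hp : p.natDegree ≤ m) (hl : l + m < N) (x : R) :
    ∑ j : Fin N, (if l ≤ (j : ℕ) ∧ (j : ℕ) ≤ l + m then p.coeff (m + l - j) else 0)
      * x ^ (N - 1 - j) = p.eval x * x ^ (N - 1 - (l + m)) := by
  rw [eval_eq_sum_range' (Nat.lt_succ_of_le hp), Finset.sum_mul,
    Fin.sum_univ_eq_sum_range (fun j => (if l ≤ j ∧ j ≤ l + m then p.coeff (m + l - j) else 0)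
      * x ^ (N - 1 - j)) N]
  symm
  apply Finset.sum_of_injOn (fun i => m + l - i)
  · intro i hi j hj h
    simp only [Finset.coe_range, Set.mem_Iio] at hi hj h
    omega
  · intro i hi
    simp only [Finset.coe_range, Set.mem_Iio] at hi ⊢
    omega
  · intro j _ hj
    rw [if_neg, zero_mul]
    rintro ⟨h1, h2⟩
    exact hj ⟨m + l - j, by simp only [Finset.coe_range, Set.mem_Iio]; omega, by
      simp only; omega⟩
  · intro i hi
    simp only [Finset.mem_range] at hi
    rw [if_pos (by omega), mul_assoc, ← pow_add]
    congr 2 <;> omega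

/-- A common root of two polynomials kills their Sylvester determinant. -/
theorem det_formalSylvester_eq_zero {R : Type*} [CommRing R] [IsDomain R] {p q : R[X]} {m k : ℕ}
    (hp : p.natDegree ≤ m) (hq : q.natDegree ≤ k) (hmk : 0 < m + k) {x : R}
    (hpx : p.eval x = 0) (hqx : q.eval x = 0) : (formalSylvester p q m k).det = 0 := by
  rw [← Matrix.exists_mulVec_eq_zero_iff]
  refine ⟨fun j => x ^ (m + k - 1 - j), fun h => ?_, ?_⟩
  · have := congrFun h ⟨m + k - 1, by omega⟩
    simp at this
  · ext i
    simp only [Matrix.mulVec, dotProduct, formalSylvester, Matrix.of_apply, Pi.zero_apply]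
    by_cases hi : (i : ℕ) < k
    · simp only [hi, if_true]
      rw [sum_window_coeff_mul_pow hp (by omega), hpx, zero_mul]
    · simp only [hi, if_false]
      have := sum_window_coeff_mul_pow (N := m + k) (l := i - k) hq (by omega) x
      rw [hqx, zero_mul] at this
      rwa [show (i : ℕ) - k + k = i by omega] at this

theorem coeff_prod_sum_of_natDegree_le {ι R : Type*} [CommRing R] (s : Finset ι) (f : ι → R[X])
    (d : ι → ℕ) (h : ∀ i ∈ s, (f i).natDegree ≤ d i) :
    (∏ i ∈ s, f i).coeff (∑ i ∈ s, d i) = ∏ i ∈ s, (f i).coeff (d i) := by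
  classical
  induction s using Finset.induction_on with
  | empty => simp
  | insert a s ha ih =>
    rw [Finset.prod_insert ha, Finset.prod_insert ha, Finset.sum_insert ha,
      coeff_mul_add_eq_of_natDegree_le (h a (by simp)), ih fun i hi => h i (by simp [hi])]
    exact (natDegree_prod_le _ _).trans
      (Finset.sum_le_sum fun i hi => h i (by simp [hi]))

theorem natDegree_det_le_sum {ι R : Type*} [CommRing R] [Fintype ι] [DecidableEq ι]
    (M : Matrix ι ι R[X]) (d : ι → ℕ) (h : ∀ i j, (M i j).natDegree ≤ d i) :
    M.det.natDegree ≤ ∑ i, d i := by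
  rw [← Matrix.det_transpose, Matrix.det_apply]
  refine natDegree_sum_le_of_forall_le _ _ fun σ _ => (natDegree_smul_le _ _).trans ?_
  exact (natDegree_prod_le _ _).trans (Finset.sum_le_sum fun i _ => h i _)

theorem coeff_det_sum {ι R : Type*} [CommRing R] [Fintype ι] [DecidableEq ι]
    (M : Matrix ι ι R[X]) (d : ι → ℕ) (h : ∀ i j, (M i j).natDegree ≤ d i) :
    M.det.coeff (∑ i, d i) = (Matrix.of fun i j => (M i j).coeff (d i)).det := by
  rw [← Matrix.det_transpose, Matrix.det_apply, ← Matrix.det_transpose, Matrix.det_apply,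
    finsetSum_coeff]
  refine Finset.sum_congr rfl fun σ _ => ?_
  rw [coeff_smul]
  congr 1
  exact coeff_prod_sum_of_natDegree_le _ _ d fun i _ => h i _

theorem isUnit_det_of_blockTriangular {ι R : Type*} [CommRing R] [Fintype ι] [DecidableEq ι]
    {M : Matrix ι ι R} {b : ι → ℕ} (hb : Function.Injective b) (hM : M.BlockTriangular b)
    (hu : ∀ i, IsUnit (M i i)) : IsUnit M.det := by
  rw [hM.det]
  refine (Finset.prod_induction _ IsUnit (fun _ _ => IsUnit.mul) isUnit_one ?_)
  intro a ha
  obtain ⟨i, -, rfl⟩ := Finset.mem_image.1 ha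
  let : Unique { j // b j = b i } := ⟨⟨⟨i, rfl⟩⟩, fun j => Subtype.ext (hb j.property)⟩
  rw [Matrix.det_unique]
  exact hu i

/-- The cyclic shift of `Fin (m + k)` sending `i < k` to `i + m`. -/
def shiftPerm (m k : ℕ) : Equiv.Perm (Fin (m + k)) where
  toFun i := if h : (i : ℕ) < k then ⟨i + m, by omega⟩ else ⟨i - k, by omega⟩
  invFun i := if h : (i : ℕ) < m then ⟨i + k, by omega⟩ else ⟨i - m, by omega⟩
  left_inv i := by
    ext
    by_cases h : (i : ℕ) < k
    · simp [h]
    · simp only [h, dite_false]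
      rw [dif_pos (by omega)]
      simp only
      omega
  right_inv i := by
    ext
    by_cases h : (i : ℕ) < m
    · simp [h]
    · simp only [h, dite_false]
      rw [dif_pos (by omega)]
      simp only
      omega

theorem shiftPerm_val {m k : ℕ} (i : Fin (m + k)) :
    (shiftPerm m k i : ℕ) = if (i : ℕ) < k then (i : ℕ) + m else i - k := by
  simp only [shiftPerm, Equiv.coe_fn_mk]
  split_ifs <;> rfl

/-- The matrix of leading coefficients, in the constant term of `p`, of the Sylvester matrix. -/
def leadingSylvester {R : Type*} [CommRing R] (q : R[X]) (m k : ℕ) :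
    Matrix (Fin (m + k)) (Fin (m + k)) R :=
  Matrix.of fun i j =>
    if (i : ℕ) < k then if (j : ℕ) = i + m then 1 else 0
    else
      if (i : ℕ) - k ≤ (j : ℕ) ∧ (j : ℕ) ≤ (i : ℕ) then q.coeff (k + ((i : ℕ) - k) - j) else 0

theorem isUnit_det_leadingSylvester {R : Type*} [CommRing R] {q : R[X]} {m k : ℕ}
    (hq : IsUnit (q.coeff k)) : IsUnit (leadingSylvester q m k).det := by
  have key : IsUnit ((leadingSylvester q m k).submatrix id (shiftPerm m k)).det := by
    refine isUnit_det_of_blockTriangular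
      (b := fun i => if (i : ℕ) < k then m + k + i else i) ?_ ?_ ?_
    · intro i j h
      ext
      simp only at h
      split_ifs at h <;> omega
    · intro i j h
      simp only at h
      simp only [leadingSylvester, Matrix.submatrix_apply, Matrix.of_apply, id, shiftPerm_val]
      by_cases hi : (i : ℕ) < k <;> by_cases hj : (j : ℕ) < k <;>
        simp only [hi, hj, if_true, if_false] at h ⊢ <;> rw [if_neg] <;> omega
    · intro i
      simp only [leadingSylvester, Matrix.submatrix_apply, Matrix.of_apply, id, shiftPerm_val]
      by_cases hi : (i : ℕ) < k
      · simp [hi]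
      · simp only [hi, if_false]
        rw [if_pos (by omega), show k + ((i : ℕ) - k) - (i - k) = k by omega]
        exact hq
  rw [Matrix.det_permute'] at key
  exact isUnit_of_mul_isUnit_right key

theorem natDegree_formalSylvester_add_X_le {R : Type*} [CommRing R] (p q : R[X]) (m k : ℕ)
    (i j : Fin (m + k)) :
    (formalSylvester (p.map C + C X) (q.map C) m k i j).natDegree ≤
      if (i : ℕ) < k then 1 else 0 := by
  simp only [formalSylvester, Matrix.of_apply]
  by_cases hi : (i : ℕ) < k
  · simp only [hi, if_true]
    split_ifs with h
    · rw [coeff_add, coeff_map, coeff_C]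
      split_ifs
      · exact natDegree_add_le_of_degree_le (by simp) natDegree_X_le
      · simp
    · simp
  · simp only [hi, if_false]
    split_ifs with h
    · simp
    · simp

theorem sum_fin_ite_lt (m k : ℕ) : ∑ i : Fin (m + k), (if (i : ℕ) < k then 1 else 0) = k := by
  rw [Fin.sum_univ_eq_sum_range (fun i => if i < k then 1 else 0) (m + k), Finset.sum_ite]
  simp only [Finset.sum_const_zero, add_zero, Finset.sum_const, smul_eq_mul, mul_one]
  rw [show (Finset.range (m + k)).filter (· < k) = Finset.range k by ext; simp; omega]
  simp

theorem natDegree_det_formalSylvester_add_X_le {R : Type*} [CommRing R] (p q : R[X]) (m k : ℕ) :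
    (formalSylvester (p.map C + C X) (q.map C) m k).det.natDegree ≤ k := by
  simpa only [sum_fin_ite_lt] using
    natDegree_det_le_sum _ _ (natDegree_formalSylvester_add_X_le p q m k)

theorem isUnit_coeff_det_formalSylvester_add_X {R : Type*} [CommRing R] (p : R[X]) {q : R[X]}
    (m : ℕ) {k : ℕ} (hq : IsUnit (q.coeff k)) :
    IsUnit ((formalSylvester (p.map C + C X) (q.map C) m k).det.coeff k) := by
  have h := coeff_det_sum _ _ (natDegree_formalSylvester_add_X_le p q m k)
  rw [sum_fin_ite_lt] at h
  rw [h]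
  convert isUnit_det_leadingSylvester (m := m) hq
  ext i j
  simp only [formalSylvester, leadingSylvester, Matrix.of_apply]
  by_cases hi : (i : ℕ) < k
  · simp only [hi, if_true]
    by_cases hj : (i : ℕ) ≤ (j : ℕ) ∧ (j : ℕ) ≤ (i : ℕ) + m
    · rw [if_pos hj, coeff_add, coeff_map, coeff_C]
      by_cases hij : (j : ℕ) = i + m
      · rw [if_pos (by omega), if_pos hij]
        simp
      · rw [if_neg (by omega), if_neg hij]
        simp
    · rw [if_neg hj, if_neg (by omega)]
      simp
  · simp only [hi, if_false]
    split_ifs <;> simp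

/-- Polynomials `t`, `u` of coprime degrees `d`, `d + 1` satisfy no nontrivial polynomial relation
of degree less than `d` in `u`. -/
theorem eval₂_compRingHom_ne_zero {K : Type*} [Field K] {t u : K[X]} {d : ℕ}
    (ht : t.natDegree = d) (hu : u.natDegree = d + 1) {P : K[X][X]} (hP : P ≠ 0)
    (hPd : P.natDegree < d) : P.eval₂ (compRingHom t) u ≠ 0 := by
  have ht0 : t.natDegree ≠ 0 := by omega
  have hu0 : u ≠ 0 := by rintro rfl; simp at hu
  have hcomp : ∀ c : K[X], c ≠ 0 → c.comp t ≠ 0 := by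
    intro c hc h
    rcases comp_eq_zero_iff.1 h with h | h
    · exact hc h
    · exact ht0 (by rw [h.2]; simp)
  have hdeg : ∀ i ∈ P.support, (compRingHom t (P.coeff i) * u ^ i).degree =
      ((P.coeff i).natDegree * d + i * (d + 1) : ℕ) := by
    intro i hi
    have h1 := hcomp _ (mem_support_iff.1 hi)
    rw [coe_compRingHom_apply, degree_eq_natDegree (mul_ne_zero h1 (pow_ne_zero _ hu0)),
      natDegree_mul h1 (pow_ne_zero _ hu0), natDegree_comp, natDegree_pow, ht, hu]
  rw [eval₂_eq_sum, Polynomial.sum, ← degree_ne_bot, degree_sum_eq_of_disjoint]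
  · obtain ⟨i, hi⟩ := nonempty_support_iff.2 hP
    intro h
    have h2 := (Finset.sup_eq_bot_iff _ _).1 h i hi
    rw [hdeg i hi] at h2
    exact WithBot.coe_ne_bot h2
  · rintro i ⟨hi, -⟩ j ⟨hj, -⟩ hij h
    simp only [Function.comp_apply] at h
    rw [hdeg i hi, hdeg j hj, Nat.cast_inj] at h
    have hid := (le_natDegree_of_mem_supp i hi).trans_lt hPd
    have hjd := (le_natDegree_of_mem_supp j hj).trans_lt hPd
    have h3 := congrArg (· % d) h
    simp only [show ∀ a i : ℕ, a * d + i * (d + 1) = i + (a + i) * d from fun a i => by ring,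
      Nat.add_mul_mod_self_right, Nat.mod_eq_of_lt hid, Nat.mod_eq_of_lt hjd] at h3
    exact hij h3

/-- A polynomial of degree `d` over a domain with unit leading coefficient is irreducible as soon
as it lies in the kernel of a homomorphism to a domain which kills no nonzero polynomial of degree
less than `d`. -/
theorem irreducible_of_kernel {S T : Type*} [CommRing S] [IsDomain S] [CommRing T] [IsDomain T]
    (ψ : S[X] →+* T) {d : ℕ} (hψ : ∀ P : S[X], P ≠ 0 → P.natDegree < d → ψ P ≠ 0)
    {D : S[X]} (hDd : D.natDegree ≤ d) (hDu : IsUnit (D.coeff d)) (hD : ψ D = 0) :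
    Irreducible D := by
  have hDeg : D.natDegree = d := le_antisymm hDd (le_natDegree_of_ne_zero hDu.ne_zero)
  have hlc : IsUnit D.leadingCoeff := by rwa [leadingCoeff, hDeg]
  have hD0 : D ≠ 0 := by rintro rfl; simp at hlc
  have aux : ∀ A B : S[X], D = A * B → ψ A = 0 → IsUnit B := by
    intro A B hAB hA
    have hA0 : A ≠ 0 := by rintro rfl; simp [hD0] at hAB
    have hB0 : B ≠ 0 := by rintro rfl; simp [hD0] at hAB
    have hAd : d ≤ A.natDegree := by
      by_contra! h
      exact hψ A hA0 h hA
    have hsum := natDegree_mul hA0 hB0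
    rw [← hAB, hDeg] at hsum
    have hB : B.natDegree = 0 := by omega
    rw [hAB, leadingCoeff_mul] at hlc
    have hBu := isUnit_of_mul_isUnit_right hlc
    rw [leadingCoeff, hB] at hBu
    rw [eq_C_of_natDegree_eq_zero hB]
    exact hBu.map C
  refine ⟨fun h => (h.map ψ).ne_zero hD, fun A B hAB => ?_⟩
  have h0 : ψ A * ψ B = 0 := by rw [← map_mul, ← hAB, hD]
  rcases mul_eq_zero.1 h0 with h | h
  · exact Or.inr (aux A B hAB h)
  · exact Or.inl (aux B A (by rw [hAB, mul_comm]) h)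

theorem coeff_derivative_of_monic {R : Type*} [CommRing R] {n : ℕ} (hn : 1 < n) {g : R[X]}
    (hg : g.Monic) (hgn : g.natDegree = n) : (derivative g).coeff (n - 1) = n := by
  have hgc : g.coeff n = 1 := by rw [← hgn]; exact hg
  rw [coeff_derivative, show n - 1 + 1 = n by omega, hgc, one_mul, Nat.cast_sub hn.le]
  simp

theorem natDegree_derivative_of_monic {R : Type*} [CommRing R] {n : ℕ} (hn : 1 < n)
    (h1 : (n : R) ≠ 0) {g : R[X]} (hg : g.Monic) (hgn : g.natDegree = n) :
    (derivative g).natDegree = n - 1 :=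
  le_antisymm ((natDegree_derivative_le g).trans (by rw [hgn]))
    (le_natDegree_of_ne_zero (by rwa [coeff_derivative_of_monic hn hg hgn]))

/-- For a monic `g` of degree `n`, the discriminant of the generic deformation `g + t x + u` is
irreducible over a field in which `n` and `n - 1` are invertible. -/
theorem irreducible_det_formalSylvester_deformation {K : Type*} [Field K] {n : ℕ} (hn : 1 < n)
    (h1 : (n : K) ≠ 0) (h2 : ((n - 1 : ℕ) : K) ≠ 0) {g : K[X]} (hg : g.Monic)
    (hgn : g.natDegree = n) :
    Irreducible (formalSylvester (((g.map C + C X * X).map C + C X : K[X][X][X]))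
      (derivative ((g.map C + C X * X).map C + C X)) n (n - 1)).det := by
  have hgc : g.coeff n = 1 := by rw [← hgn]; exact hg
  have hg'c := coeff_derivative_of_monic hn hg hgn
  have hg'd := natDegree_derivative_of_monic hn h1 hg hgn
  set t : K[X] := -derivative g with ht
  set u : K[X] := X * derivative g - g with hu
  have htd : t.natDegree = n - 1 := by rw [ht, natDegree_neg, hg'd]
  have hud : u.natDegree = (n - 1) + 1 := by
    refine le_antisymm ?_ (le_natDegree_of_ne_zero ?_)
    · refine (natDegree_sub_le _ _).trans (max_le ?_ (by omega))
      refine natDegree_mul_le.trans ?_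
      rw [hg'd, natDegree_X]
      omega
    · rw [hu, coeff_sub, coeff_X_mul, hg'c, show n - 1 + 1 = n by omega, hgc]
      rwa [Nat.cast_sub hn.le, Nat.cast_one] at h2
  have hder : derivative ((g.map C + C X * X).map C + C X : K[X][X][X]) =
      ((derivative g).map C + C X).map C := by
    simp
  rw [hder]
  refine irreducible_of_kernel (eval₂RingHom (compRingHom t) u) (d := n - 1)
    (fun P hP hPd => eval₂_compRingHom_ne_zero htd hud hP hPd)
    (natDegree_det_formalSylvester_add_X_le _ _ _ _)
    (isUnit_coeff_det_formalSylvester_add_X _ _ ?_) ?_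
  · rw [coeff_add, coeff_map, hg'c, coeff_C, if_neg (by omega), add_zero]
    exact (isUnit_iff_ne_zero.2 h1).map C
  · rw [← det_formalSylvester_map]
    have hψ : (eval₂RingHom (compRingHom t) u).comp (C.comp C) = (C : K →+* K[X]) := by
      ext; simp
    have hp : ((g.map C + C X * X).map C + C X : K[X][X][X]).map
        (eval₂RingHom (compRingHom t) u) = g.map C + C t * X + C u := by
      simp [Polynomial.map_map, hψ]
    have hq : (((derivative g).map C + C X).map C : K[X][X][X]).map
        (eval₂RingHom (compRingHom t) u) = (derivative g).map C + C t := by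
      simp [Polynomial.map_map, hψ]
    rw [hp, hq]
    refine det_formalSylvester_eq_zero ?_ ?_ (by omega) (x := X) ?_ ?_
    · refine (natDegree_add_le _ _).trans (max_le ((natDegree_add_le _ _).trans (max_le ?_ ?_)) ?_)
      · exact natDegree_map_le.trans hgn.le
      · exact (natDegree_C_mul_le _ _).trans (natDegree_X_le.trans hn.le)
      · simp
    · refine (natDegree_add_le _ _).trans (max_le (natDegree_map_le.trans hg'd.le) (by simp))
    · simp only [eval_add, eval_mul, eval_C, eval_X, eval_map, eval₂_C_X, ht, hu]
      ring
    · simp [eval_map, eval₂_C_X, ht]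

theorem natCast_ne_zero_of_ringChar {K : Type*} [Field K] {N : ℕ} (hN : N ≠ 0)
    (h : ringChar K = 0 ∨ Nat.Coprime (ringChar K) N) : (N : K) ≠ 0 := by
  intro h0
  have hd := ringChar.dvd h0
  rcases h with h | h
  · rw [h, zero_dvd_iff] at hd
    exact hN hd
  · have h1 : ringChar K = 1 := Nat.eq_one_of_dvd_coprimes h dvd_rfl hd
    exact CharP.ringChar_ne_one h1

theorem monic_X_pow_add_tail {R : Type*} [CommRing R] [Nontrivial R] {n : ℕ} (hn : 1 < n)
    (a : ℕ → R) :
    (X ^ n + ∑ i ∈ Finset.Icc 2 (n - 2), C (a i) * X ^ (n - i)).Monic ∧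
    (X ^ n + ∑ i ∈ Finset.Icc 2 (n - 2), C (a i) * X ^ (n - i)).natDegree = n := by
  have h : (∑ i ∈ Finset.Icc 2 (n - 2), C (a i) * X ^ (n - i)).degree < (n : WithBot ℕ) := by
    refine (degree_sum_le _ _).trans_lt ((Finset.sup_lt_iff (WithBot.bot_lt_coe n)).2 ?_)
    intro i hi
    rw [Finset.mem_Icc] at hi
    exact (degree_C_mul_X_pow_le _ _).trans_lt (WithBot.coe_lt_coe.2 (show n - i < n by omega))
  refine ⟨monic_X_pow_add h, ?_⟩
  rw [natDegree_add_eq_left_of_degree_lt (by rwa [degree_X_pow]), natDegree_X_pow]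

theorem monic_add_linear {R : Type*} [CommRing R] [Nontrivial R] {n : ℕ} (hn : 1 < n) {g : R[X]}
    (hg : g.Monic) (hgn : g.natDegree = n) (s t : R) :
    (g + (C s * X + C t)).Monic ∧ (g + (C s * X + C t)).natDegree = n := by
  have h : (C s * X + C t).degree < g.degree := by
    rw [degree_eq_natDegree hg.ne_zero, hgn]
    exact degree_linear_le.trans_lt (by exact_mod_cast hn)
  exact ⟨hg.add_of_left h, by rw [natDegree_add_eq_left_of_degree_lt h, hgn]⟩

end DiscriminantIrreducible

/-- **Irreducibility of the discriminant in the last two coefficients.**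
Let `n > 1` and let `K` be a field whose characteristic is zero or coprime to
`n * (n - 1)`. Fix `a 2, …, a (n-2) ∈ K`, and let `a_{n-1}`, `a_n` be the two
indeterminates `X 0`, `X 1` of `R = K[a_{n-1}, a_n] = MvPolynomial (Fin 2) K`.
Then the discriminant of
`f = x ^ n + a_2 x ^ (n-2) + ⋯ + a_{n-2} x ^ 2 + a_{n-1} x + a_n ∈ R[x]`
is irreducible in `R`. -/
theorem discriminant_irreducible_two_vars
    (n : ℕ) (hn : 1 < n) (K : Type) [Field K]
    (hchar : ringChar K = 0 ∨ Nat.Coprime (ringChar K) (n * (n - 1)))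
    (a : ℕ → K) :
    Irreducible (polyDisc
      ((Polynomial.X : Polynomial (MvPolynomial (Fin 2) K)) ^ n
        + ∑ i ∈ Finset.Icc 2 (n - 2),
            Polynomial.C (MvPolynomial.C (a i)) * Polynomial.X ^ (n - i)
        + Polynomial.C (MvPolynomial.X 0) * Polynomial.X
        + Polynomial.C (MvPolynomial.X 1))) := by
  have hN : n * (n - 1) ≠ 0 := Nat.mul_ne_zero (by omega) (by omega)
  have hK := DiscriminantIrreducible.natCast_ne_zero_of_ringChar hN hchar
  rw [Nat.cast_mul] at hK
  obtain ⟨hg, hgn⟩ := DiscriminantIrreducible.monic_X_pow_add_tail hn a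
  set g : K[X] := X ^ n + ∑ i ∈ Finset.Icc 2 (n - 2), C (a i) * X ^ (n - i) with hgdef
  have hirr := DiscriminantIrreducible.irreducible_det_formalSylvester_deformation hn
    (left_ne_zero_of_mul hK) (right_ne_zero_of_mul hK) hg hgn
  set e := Polynomial.Bivariate.equivMvPolynomial K
  set F : K[X][X][X] := (g.map C + C X * X).map C + C X with hF
  set f : (MvPolynomial (Fin 2) K)[X] := X ^ n
    + ∑ i ∈ Finset.Icc 2 (n - 2), C (MvPolynomial.C (a i)) * X ^ (n - i)
    + C (MvPolynomial.X 0) * X + C (MvPolynomial.X 1) with hf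
  have hfF : f = F.map (e : K[X][X] →+* MvPolynomial (Fin 2) K) := by
    simp [hf, hF, hgdef, e, Polynomial.map_sum]
  have hfm : f.Monic ∧ f.natDegree = n := by
    obtain ⟨hm, hd⟩ := DiscriminantIrreducible.monic_X_pow_add_tail hn
      fun i => (MvPolynomial.C (a i) : MvPolynomial (Fin 2) K)
    simpa only [hf, add_assoc] using DiscriminantIrreducible.monic_add_linear hn hm hd
      (MvPolynomial.X 0) (MvPolynomial.X 1)
  have hn' : (n : MvPolynomial (Fin 2) K) ≠ 0 := by
    rw [← map_natCast (MvPolynomial.C : K →+* MvPolynomial (Fin 2) K), Ne, MvPolynomial.C_eq_zero]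
    exact left_ne_zero_of_mul hK
  have hdet : polyRes f (derivative f) =
      e (DiscriminantIrreducible.formalSylvester F (derivative F) n (n - 1)).det := by
    rw [DiscriminantIrreducible.polyRes_eq_det_formalSylvester hfm.2
      (DiscriminantIrreducible.natDegree_derivative_of_monic hn hn' hfm.1 hfm.2), hfF,
      derivative_map, DiscriminantIrreducible.det_formalSylvester_map]
    rfl
  rw [polyDisc, hdet, irreducible_isUnit_mul (isUnit_one.neg.pow _), MulEquiv.irreducible_iff]
  exact hirr
end

section
/- Let n > 1 be an integer and let K be a field whose characteristic is zero or coprime to n(n-1). Regard a_2, …, a_n as indeterminates and work in the polynomial ring R = K[a_2, …, a_n] in n−1 variables. Let f(x) = x^n + a_2 x^{n-2} + ⋯ + a_{n-1} x + a_n ∈ R[x] and let Δ = disc(f) ∈ R. Then Δ is irreducible in K[a_2, …, a_n]. -/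
open Polynomial

/-- The Sylvester determinant `polyRes` agrees with Mathlib's resultant. -/
lemma polyRes_eq_resultant {R : Type*} [CommRing R] (p q : R[X]) :
    polyRes p q = resultant p q := by
  have h : sylvesterMatrix p q =
      (Matrix.transpose (sylvester p q p.natDegree q.natDegree)).submatrix
        Fin.revPerm Fin.revPerm := by
    ext i j
    simp only [sylvesterMatrix, Matrix.of_apply, Matrix.submatrix_apply, Matrix.transpose_apply,
      Fin.revPerm_apply]
    generalize hk : i.rev = k
    have hk' : (i : ℕ) + k + 1 = p.natDegree + q.natDegree := by
      rw [← hk, Fin.val_rev]; lia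
    have hj : ((j.rev : Fin _) : ℕ) = p.natDegree + q.natDegree - (j + 1) := Fin.val_rev j
    have := j.2
    induction k using Fin.addCases with
    | left k =>
      have := k.2
      simp only [Fin.val_castAdd] at hk'
      simp only [sylvester, Matrix.of_apply, Fin.addCases_left, Set.mem_Icc, hj]
      rw [if_neg (by lia)]
      refine if_ctx_congr (by lia) (fun h ↦ ?_) (fun _ ↦ rfl)
      congr 1; lia
    | right k =>
      have := k.2
      simp only [Fin.val_natAdd] at hk'
      simp only [sylvester, Matrix.of_apply, Fin.addCases_right, Set.mem_Icc, hj]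
      rw [if_pos (by lia)]
      refine if_ctx_congr (by lia) (fun h ↦ ?_) (fun _ ↦ rfl)
      congr 1; lia
  rw [polyRes, h, Matrix.det_submatrix_equiv_self, Matrix.det_transpose, resultant]

/-- The monic polynomial `x ^ n + c₀ x ^ (n-2) + c₁ x ^ (n-3) + ⋯` of degree `n` without
`x ^ (n-1)` term. -/
noncomputable def depressedPoly {R : Type*} [CommRing R] (n : ℕ) (c : Fin (n - 1) → R) : R[X] :=
  X ^ n + ∑ i : Fin (n - 1), C (c i) * X ^ (n - ((i : ℕ) + 2))

section depressedPoly

variable {R S : Type*} [CommRing R] [CommRing S] {n : ℕ} (c : Fin (n - 1) → R)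

lemma degree_depressedPoly_tail_lt :
    (∑ i : Fin (n - 1), C (c i) * X ^ (n - ((i : ℕ) + 2))).degree < (n : WithBot ℕ) := by
  refine (degree_sum_le _ _).trans_lt ((Finset.sup_lt_iff (WithBot.bot_lt_coe n)).2 fun i _ ↦ ?_)
  refine (degree_C_mul_X_pow_le _ _).trans_lt ?_
  have := i.2
  exact Nat.cast_lt.2 (by lia)

lemma depressedPoly_monic : (depressedPoly n c).Monic :=
  monic_X_pow_add (degree_depressedPoly_tail_lt c)

lemma natDegree_depressedPoly [Nontrivial R] : (depressedPoly n c).natDegree = n :=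
  natDegree_eq_of_degree_eq_some <| by
    rw [depressedPoly, degree_add_eq_left_of_degree_lt, degree_X_pow]
    rw [degree_X_pow]
    exact degree_depressedPoly_tail_lt c

lemma map_depressedPoly (φ : R →+* S) :
    (depressedPoly n c).map φ = depressedPoly n (φ ∘ c) := by
  simp [depressedPoly, Polynomial.map_sum]

lemma natDegree_derivative_of_monic {p : R[X]} (hp : p.Monic) (h : (p.natDegree : R) ≠ 0) :
    (derivative p).natDegree = p.natDegree - 1 := by
  refine le_antisymm (natDegree_derivative_le p) (le_natDegree_of_ne_zero ?_)
  have h0 : p.natDegree ≠ 0 := by rintro h0; simp [h0] at h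
  have h1 : p.natDegree - 1 + 1 = p.natDegree := by lia
  have h2 : ((p.natDegree - 1 : ℕ) : R) + 1 = p.natDegree := by exact_mod_cast congrArg _ h1
  rw [coeff_derivative, h1, hp.coeff_natDegree, one_mul, h2]
  exact h

lemma natDegree_derivative_depressedPoly [Nontrivial R] (h : (n : R) ≠ 0) :
    (derivative (depressedPoly n c)).natDegree = n - 1 := by
  rw [natDegree_derivative_of_monic (depressedPoly_monic c), natDegree_depressedPoly]
  rwa [natDegree_depressedPoly]

lemma polyDisc_depressedPoly [Nontrivial R] (h : (n : R) ≠ 0) :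
    polyDisc (depressedPoly n c) = (-1) ^ (n * (n - 1) / 2) *
      resultant (depressedPoly n c) (derivative (depressedPoly n c)) n (n - 1) := by
  rw [polyDisc, polyRes_eq_resultant, natDegree_depressedPoly,
    natDegree_derivative_depressedPoly c h]

lemma map_polyDisc_depressedPoly [Nontrivial R] [Nontrivial S] (φ : R →+* S) (h : (n : S) ≠ 0) :
    φ (polyDisc (depressedPoly n c)) = polyDisc (depressedPoly n (φ ∘ c)) := by
  have h' : (n : R) ≠ 0 := fun h0 ↦ h (by rw [← map_natCast φ, h0, map_zero])
  rw [polyDisc_depressedPoly _ h, polyDisc_depressedPoly _ h', ← map_depressedPoly,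
    derivative_map, resultant_map_map]
  simp

lemma scaleRoots_depressedPoly [Nontrivial R] (t : R) :
    (depressedPoly n c).scaleRoots t = depressedPoly n fun i ↦ c i * t ^ ((i : ℕ) + 2) := by
  ext k
  rw [coeff_scaleRoots, natDegree_depressedPoly]
  simp only [depressedPoly, coeff_add, coeff_X_pow, finsetSum_coeff, coeff_C_mul, add_mul,
    Finset.sum_mul]
  congr 1
  · split_ifs with h <;> simp [h]
  · refine Finset.sum_congr rfl fun i _ ↦ ?_
    have := i.2
    split_ifs with h
    · rw [h, show n - (n - ((i : ℕ) + 2)) = i + 2 by lia]; ring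
    · simp

lemma derivative_scaleRoots_of_natDegree_derivative {p : R[X]}
    (h : (derivative p).natDegree = p.natDegree - 1) (t : R) :
    derivative (p.scaleRoots t) = (derivative p).scaleRoots t := by
  ext k
  rw [coeff_derivative, coeff_scaleRoots, coeff_scaleRoots, coeff_derivative, h,
    show p.natDegree - (k + 1) = p.natDegree - 1 - k by lia]
  ring

lemma polyDisc_depressedPoly_weighted [Nontrivial R] (h : (n : R) ≠ 0) (t : R) :
    polyDisc (depressedPoly n fun i ↦ c i * t ^ ((i : ℕ) + 2)) =
      t ^ (n * (n - 1)) * polyDisc (depressedPoly n c) := by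
  rw [← scaleRoots_depressedPoly, polyDisc, polyDisc, polyRes_eq_resultant, polyRes_eq_resultant,
    derivative_scaleRoots_of_natDegree_derivative, resultant_scaleRoots, natDegree_scaleRoots,
    natDegree_depressedPoly, natDegree_derivative_depressedPoly c h]
  · ring
  · rw [natDegree_derivative_depressedPoly c h, natDegree_depressedPoly]

end depressedPoly

lemma depressedPoly_single {R : Type*} [CommRing R] {n : ℕ} (i : Fin (n - 1)) :
    depressedPoly n (Pi.single i (1 : R)) = X ^ n + X ^ (n - ((i : ℕ) + 2)) := by
  rw [depressedPoly, Finset.sum_eq_single i]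
  · simp
  · intro j _ hj; simp [Pi.single_eq_of_ne hj]
  · simp

lemma polyDisc_ne_zero_of_separable {K : Type*} [Field K] {p : K[X]} (hp : p.Separable) :
    polyDisc p ≠ 0 := by
  rw [polyDisc, polyRes_eq_resultant]
  exact mul_ne_zero (pow_ne_zero _ (by simp)) (resultant_ne_zero _ _ hp)

lemma separable_X_pow_add_one {K : Type*} [Field K] {n : ℕ} (hn : (n : K) ≠ 0) :
    (X ^ n + 1 : K[X]).Separable := by
  simpa using separable_X_pow_sub_C (-1 : K) hn (by simp)

lemma separable_X_pow_succ_add_X {K : Type*} [Field K] {n : ℕ} (hn : (n : K) ≠ 0) :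
    (X ^ (n + 1) + X : K[X]).Separable := by
  have h0 : n ≠ 0 := by rintro rfl; simp at hn
  rw [show (X ^ (n + 1) + X : K[X]) = X * (X ^ n + 1) by ring]
  refine separable_X.mul (separable_X_pow_add_one hn) ⟨-X ^ (n - 1), 1, ?_⟩
  obtain ⟨m, rfl⟩ := Nat.exists_eq_succ_of_ne_zero h0
  simp only [Nat.succ_eq_add_one, Nat.add_sub_cancel]
  ring

section weight

variable {σ K : Type*} [Field K] (w : σ → ℕ)

/-- The substitution `X i ↦ X i * T ^ w i`, which turns a weighted homogeneous polynomial `G` of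
weight `k` into `G * T ^ k`. -/
noncomputable def weightHom : MvPolynomial σ K →+* (MvPolynomial σ K)[X] :=
  (MvPolynomial.aeval fun i ↦ C (MvPolynomial.X i) * X ^ w i :
    MvPolynomial σ K →ₐ[K] (MvPolynomial σ K)[X])

lemma weightHom_X (i : σ) :
    weightHom w (MvPolynomial.X i : MvPolynomial σ K) = C (MvPolynomial.X i) * X ^ w i := by
  simp [weightHom]

lemma weightHom_C (a : K) : weightHom w (MvPolynomial.C a : MvPolynomial σ K) =
    C (MvPolynomial.C a) := by
  simp [weightHom]

lemma eval_one_weightHom (G : MvPolynomial σ K) : (weightHom w G).eval 1 = G := by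
  have : (evalRingHom 1).comp (weightHom w) = RingHom.id (MvPolynomial σ K) := by
    ext i <;> simp [weightHom_X, weightHom_C]
  exact congrArg (fun f : MvPolynomial σ K →+* MvPolynomial σ K ↦ f G) this

lemma eval_zero_weightHom (hw : ∀ i, w i ≠ 0) (G : MvPolynomial σ K) :
    (weightHom w G).eval 0 = MvPolynomial.C (MvPolynomial.constantCoeff G) := by
  have : (evalRingHom 0).comp (weightHom w) =
      (MvPolynomial.C.comp MvPolynomial.constantCoeff :
        MvPolynomial σ K →+* MvPolynomial σ K) := by
    ext i <;> simp [weightHom_X, weightHom_C, hw]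
  exact congrArg (fun f : MvPolynomial σ K →+* MvPolynomial σ K ↦ f G) this

variable {w}

/-- Factors of a nonzero weighted homogeneous polynomial are weighted homogeneous. -/
lemma exists_weightHom_eq_of_mul {G H : MvPolynomial σ K} {N : ℕ}
    (h0 : G * H ≠ 0) (h : weightHom w (G * H) = C (G * H) * X ^ N) :
    ∃ i j, i + j = N ∧ weightHom w G = C G * X ^ i ∧ weightHom w H = C H * X ^ j := by
  rw [map_mul] at h
  obtain ⟨i, j, b, c, hij, hbc, hb, hc⟩ := mul_eq_mul_prime_pow prime_X h
  have hbc0 : b * c ≠ 0 := by rw [← hbc]; exact C_ne_zero.2 h0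
  have hdeg : b.natDegree + c.natDegree = 0 := by
    rw [← natDegree_mul (left_ne_zero_of_mul hbc0) (right_ne_zero_of_mul hbc0), ← hbc, natDegree_C]
  have aux {P : MvPolynomial σ K} {p : (MvPolynomial σ K)[X]} {k : ℕ} (hp : p.natDegree = 0)
      (hP : weightHom w P = p * X ^ k) : weightHom w P = C P * X ^ k := by
    obtain ⟨q, rfl⟩ := natDegree_eq_zero.1 hp
    have := eval_one_weightHom w P
    rw [hP] at this
    simp only [eval_mul, eval_C, eval_pow, eval_X, one_pow, mul_one] at this
    rw [hP, this]
  exact ⟨i, j, hij, aux (by lia) hb, aux (by lia) hc⟩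

lemma weight_dvd_of_eval_single_ne_zero [DecidableEq σ] {G : MvPolynomial σ K} {k : ℕ} (i : σ)
    (hi : w i ≠ 0) (hG : weightHom w G = C G * X ^ k)
    (h0 : MvPolynomial.eval (Pi.single i 1) G ≠ 0) : w i ∣ k := by
  set e : MvPolynomial σ K →+* K := MvPolynomial.eval (Pi.single i 1)
  have key : (mapRingHom e).comp (weightHom w) =
      ((expand K (w i) : K[X] →+* K[X])).comp
        (MvPolynomial.eval₂Hom C fun j ↦ C ((Pi.single i 1 : σ → K) j) * X) := by
    refine MvPolynomial.ringHom_ext' (RingHom.ext fun a ↦ ?_) fun j ↦ ?_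
    · simp [weightHom_C, e]
    · obtain rfl | hj := eq_or_ne j i
      · simp [weightHom_X, e]
      · simp [weightHom_X, e, Pi.single_eq_of_ne hj]
  have h1 := congrArg (fun f : MvPolynomial σ K →+* K[X] ↦ (f G).coeff k) key
  simp only [RingHom.comp_apply, hG, coe_mapRingHom, RingHom.coe_coe, Polynomial.map_mul, map_C,
    Polynomial.map_pow, map_X, coeff_C_mul_X_pow, if_true] at h1
  rw [coeff_expand (Nat.pos_of_ne_zero hi)] at h1
  by_contra hd
  rw [if_neg hd] at h1
  exact h0 h1

lemma isUnit_of_weightHom_eq (hw : ∀ i, w i ≠ 0) {G : MvPolynomial σ K} (h0 : G ≠ 0)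
    (hG : weightHom w G = C G) : IsUnit G := by
  have h := eval_zero_weightHom w hw G
  rw [hG, eval_C] at h
  rw [h] at h0 ⊢
  exact (IsUnit.mk0 _ fun h1 ↦ h0 (by rw [h1, map_zero])).map MvPolynomial.C

end weight

lemma natCast_ne_zero_of_ringChar {K : Type*} [Field K] {m n : ℕ} (hn : n ≠ 0) (hdvd : n ∣ m)
    (hchar : ringChar K = 0 ∨ Nat.Coprime (ringChar K) m) : (n : K) ≠ 0 := by
  intro h
  have hd : ringChar K ∣ n := (ringChar.spec K n).1 h
  obtain h0 | h0 := hchar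
  · rw [h0, zero_dvd_iff] at hd
    exact hn hd
  · exact CharP.ringChar_ne_one (Nat.eq_one_of_dvd_coprimes h0 dvd_rfl (hd.trans hdvd))

/-- **Irreducibility of the discriminant as a polynomial in all coefficients.**
Let `n > 1` and let `K` be a field whose characteristic is zero or coprime to
`n * (n - 1)`. Regard `a_2, …, a_n` as indeterminates (the variable `X i` of
`R = MvPolynomial (Fin (n - 1)) K` corresponds to `a_{i+2}`). Then the
discriminant of `f = x ^ n + a_2 x ^ (n-2) + ⋯ + a_{n-1} x + a_n ∈ R[x]`
is irreducible in `R = K[a_2, …, a_n]`. -/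
theorem discriminant_irreducible_all_vars
    (n : ℕ) (hn : 1 < n) (K : Type) [Field K]
    (hchar : ringChar K = 0 ∨ Nat.Coprime (ringChar K) (n * (n - 1))) :
    Irreducible (polyDisc
      ((Polynomial.X : Polynomial (MvPolynomial (Fin (n - 1)) K)) ^ n
        + ∑ i : Fin (n - 1),
            Polynomial.C (MvPolynomial.X i) * Polynomial.X ^ (n - ((i : ℕ) + 2)))) := by
  change Irreducible (polyDisc (depressedPoly n
    (MvPolynomial.X : Fin (n - 1) → MvPolynomial (Fin (n - 1)) K)))
  have hnK : (n : K) ≠ 0 := natCast_ne_zero_of_ringChar (by lia) (Dvd.intro _ rfl) hchar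
  have hnK' : ((n - 1 : ℕ) : K) ≠ 0 :=
    natCast_ne_zero_of_ringChar (by lia) (Dvd.intro_left _ rfl) hchar
  have hnR : (n : MvPolynomial (Fin (n - 1)) K) ≠ 0 := by
    rw [← map_natCast MvPolynomial.C]
    exact (map_ne_zero_iff _ (MvPolynomial.C_injective _ _)).2 hnK
  have hnT : (n : (MvPolynomial (Fin (n - 1)) K)[X]) ≠ 0 := by
    rw [← map_natCast Polynomial.C]
    exact (map_ne_zero_iff _ Polynomial.C_injective).2 hnR
  set D := polyDisc (depressedPoly n
    (MvPolynomial.X : Fin (n - 1) → MvPolynomial (Fin (n - 1)) K)) with hD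
  set w : Fin (n - 1) → ℕ := fun i ↦ i + 2 with hw
  have hw0 : ∀ i, w i ≠ 0 := fun i ↦ by simp [hw]
  have hwD : weightHom w D = C D * X ^ (n * (n - 1)) := by
    rw [hD, map_polyDisc_depressedPoly _ _ hnT, map_polyDisc_depressedPoly _ C hnT, mul_comm,
      ← polyDisc_depressedPoly_weighted _ hnT]
    congr 2
    ext1 i
    simp [weightHom_X, hw]
  have hsingle (i : Fin (n - 1)) : MvPolynomial.eval (Pi.single i 1) D =
      polyDisc (X ^ n + X ^ (n - ((i : ℕ) + 2)) : K[X]) := by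
    rw [hD, map_polyDisc_depressedPoly _ _ hnK, ← depressedPoly_single]
    congr 2
    ext1 j
    simp
  have hlast : MvPolynomial.eval (Pi.single (⟨n - 2, by lia⟩ : Fin (n - 1)) 1) D ≠ 0 := by
    rw [hsingle, show n - (n - 2 + 2) = 0 by lia, pow_zero]
    exact polyDisc_ne_zero_of_separable (separable_X_pow_add_one hnK)
  have hprev (h : n - 3 < n - 1) (h2 : 2 < n) :
      MvPolynomial.eval (Pi.single (⟨n - 3, h⟩ : Fin (n - 1)) 1) D ≠ 0 := by
    rw [hsingle, show n - (n - 3 + 2) = 1 by lia, pow_one]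
    have := separable_X_pow_succ_add_X hnK'
    rw [show n - 1 + 1 = n by lia] at this
    exact polyDisc_ne_zero_of_separable this
  have hD0 : D ≠ 0 := by
    intro h
    rw [h] at hlast
    simp at hlast
  have hdvd {G H : MvPolynomial (Fin (n - 1)) K} (hGH : D = G * H) {k : ℕ}
      (hG : weightHom w G = C G * X ^ k) : n * (n - 1) ∣ k := by
    refine Nat.Coprime.mul_dvd_of_dvd_of_dvd
      ((Nat.coprime_self_sub_right hn.le).2 (Nat.coprime_one_right n)) ?_ ?_
    · rw [hGH, map_mul] at hlast
      have := weight_dvd_of_eval_single_ne_zero _ (hw0 _) hG (left_ne_zero_of_mul hlast)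
      rwa [show w ⟨n - 2, by lia⟩ = n by simp only [hw]; lia] at this
    · obtain rfl | h2 : n = 2 ∨ 2 < n := by lia
      · exact one_dvd k
      have h3 := hprev (by lia) h2
      rw [hGH, map_mul] at h3
      have := weight_dvd_of_eval_single_ne_zero _ (hw0 _) hG (left_ne_zero_of_mul h3)
      rwa [show w ⟨n - 3, by lia⟩ = n - 1 by simp only [hw]; lia] at this
  have hN : n * (n - 1) ≠ 0 := mul_ne_zero (by lia) (by lia)
  refine ⟨fun hu ↦ ?_, fun G H hGH ↦ ?_⟩
  · obtain ⟨a, ha, hDa⟩ := MvPolynomial.isUnit_iff_eq_C_of_isReduced.1 hu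
    rw [hDa, weightHom_C] at hwD
    have h2 := congrArg (Polynomial.eval 0) hwD
    simp only [eval_C, eval_mul, eval_pow, eval_X, zero_pow hN, mul_zero] at h2
    exact hD0 (hDa.trans h2)
  · obtain ⟨i, j, hij, hG, hH⟩ := exists_weightHom_eq_of_mul (w := w) (N := n * (n - 1))
      (by rw [← hGH]; exact hD0) (by rw [← hGH]; exact hwD)
    have hG0 : G ≠ 0 := by rintro rfl; exact hD0 (by rw [hGH, zero_mul])
    have hH0 : H ≠ 0 := by rintro rfl; exact hD0 (by rw [hGH, mul_zero])
    have hi := hdvd hGH hG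
    obtain rfl | hi0 := Nat.eq_zero_or_pos i
    · left
      exact isUnit_of_weightHom_eq hw0 hG0 (by simpa using hG)
    · right
      have := Nat.le_of_dvd hi0 hi
      obtain rfl : j = 0 := by lia
      exact isUnit_of_weightHom_eq hw0 hH0 (by simpa using hH)
end

section
/- Let k be an algebraically closed field with char(k) ≠ 2, m ≥ 1, and J ∈ GL_m(k) a symmetric invertible matrix. Suppose T, T′ ∈ M_m(k) are self-adjoint with respect to J (T* = T and T′* = T′, where M* = J⁻¹ Mᵀ J), both are regular (minimal polynomial equals characteristic polynomial), and T and T′ have the same characteristic polynomial. Then there exists h ∈ GL_m(k) with hᵀ J h = J and T′ = h T h⁻¹; that is, T and T′ are conjugate by an element of the orthogonal group O(J)(k). -/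
open Matrix

open Polynomial in
/-- Modulo a polynomial with nonzero constant term, `X` has a square root. -/
theorem Polynomial.exists_dvd_sq_sub_X {k : Type*} [Field k] [IsAlgClosed k] (h2 : (2 : k) ≠ 0)
    {f : k[X]} (hf : f.eval 0 ≠ 0) : ∃ q : k[X], f ∣ q ^ 2 - X := by
  classical
  have hf0 : f ≠ 0 := by rintro rfl; simp at hf
  choose s hs using fun a : k => IsAlgClosed.exists_pow_nat_eq a (n := 2) (by norm_num)
  let r := Lagrange.interpolate f.roots.toFinset id s
  have hroot : ∀ a ∈ f.roots, X - C a ∣ r ^ 2 - X := by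
    intro a ha
    have : r.eval a = s a :=
      Lagrange.eval_interpolate_at_node (v := id) s Function.injective_id.injOn
        (Multiset.mem_toFinset.2 ha)
    rw [dvd_iff_isRoot]
    simp [this, hs]
  have hnil : f ∣ (r ^ 2 - X) ^ f.roots.card := by
    have h := Multiset.prod_dvd_prod_of_dvd _ _ hroot
    rw [Multiset.map_const', Multiset.prod_replicate] at h
    rw [(IsAlgClosed.splits f).eq_prod_roots, IsUnit.mul_left_dvd]
    · rwa [← (IsAlgClosed.splits f).eq_prod_roots]
    · simpa using hf0
  let x : AdjoinRoot f := AdjoinRoot.mk f r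
  let P : (AdjoinRoot f)[X] := X ^ 2 - C (AdjoinRoot.root f)
  have hxn : IsNilpotent (x ^ 2 - AdjoinRoot.root f) := by
    refine ⟨f.roots.card, ?_⟩
    rw [← AdjoinRoot.mk_X, ← map_pow, ← map_sub, ← map_pow]
    exact AdjoinRoot.mk_eq_zero.2 hnil
  have hu : IsUnit (AdjoinRoot.root f) := by
    have hcop : IsCoprime (X : k[X]) f := by
      rw [irreducible_X.coprime_iff_not_dvd, X_dvd_iff, coeff_zero_eq_eval_zero]
      exact hf
    obtain ⟨a, b, hab⟩ := hcop
    refine IsUnit.of_mul_eq_one_right (AdjoinRoot.mk f a) ?_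
    have := congrArg (AdjoinRoot.mk f) hab
    simpa using this
  have hxu : IsUnit x := by
    have h := hxn.isUnit_add_right_of_commute hu (Commute.all _ _)
    rw [sub_add_cancel] at h
    exact isUnit_pow_iff two_ne_zero |>.1 h
  have h2u : IsUnit (2 : AdjoinRoot f) := by
    have := (IsUnit.mk0 (2 : k) h2).map (algebraMap k (AdjoinRoot f))
    rwa [map_ofNat] at this
  obtain ⟨y, ⟨-, hy⟩, -⟩ := existsUnique_nilpotent_sub_and_aeval_eq_zero (P := P) (x := x)
    (by simpa [P] using hxn) (by simpa [P, one_add_one_eq_two] using h2u.mul hxu)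
  obtain ⟨q, rfl⟩ := AdjoinRoot.mk_surjective y
  refine ⟨q, AdjoinRoot.mk_eq_zero.1 ?_⟩
  simpa [P] using hy

open Polynomial in
/-- An invertible matrix over an algebraically closed field of characteristic not two has a square
root which is a polynomial in the matrix. -/
theorem Matrix.exists_aeval_sq_eq {k n : Type*} [Field k] [IsAlgClosed k] [Fintype n]
    [DecidableEq n] (h2 : (2 : k) ≠ 0) {S : Matrix n n k} (hS : IsUnit S) :
    ∃ q : k[X], aeval S q ^ 2 = S := by
  have hdet : S.charpoly.eval 0 ≠ 0 := by
    rw [Matrix.eval_charpoly]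
    simpa [Matrix.det_neg] using ((Matrix.isUnit_iff_isUnit_det S).1 hS).ne_zero
  obtain ⟨q, c, hq⟩ := exists_dvd_sq_sub_X h2 hdet
  refine ⟨q, sub_eq_zero.1 ?_⟩
  simpa [Matrix.aeval_self_charpoly] using congrArg (aeval S) hq

open Polynomial in
/-- Over an algebraically closed field, some vector has annihilating polynomials exactly the
multiples of the minimal polynomial. -/
theorem Module.End.exists_minpoly_dvd_of_aeval_apply_eq_zero {k V : Type*} [Field k]
    [IsAlgClosed k] [AddCommGroup V] [Module k V] [FiniteDimensional k V] (T : Module.End k V) :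
    ∃ v : V, ∀ p : k[X], aeval T p v = 0 → minpoly k T ∣ p := by
  classical
  set f := minpoly k T with hf
  have hint : IsIntegral k T := Algebra.IsIntegral.isIntegral T
  have hf0 : f ≠ 0 := minpoly.ne_zero hint
  obtain ⟨v, hv⟩ : ∃ v : V, ∀ a : f.roots.toFinset,
      aeval T (f /ₘ (X - C (a : k))) v ≠ 0 := by
    by_contra! h
    have hcov : (⋃ a : f.roots.toFinset,
        ((LinearMap.ker (aeval T (f /ₘ (X - C (a : k))))) : Set V)) = Set.univ := by
      refine Set.eq_univ_of_forall fun v => ?_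
      obtain ⟨a, ha⟩ := h v
      exact Set.mem_iUnion.2 ⟨a, ha⟩
    obtain ⟨a, ha⟩ := Subspace.exists_eq_top_of_iUnion_eq_univ hcov
    have hroot : f.IsRoot a := isRoot_of_mem_roots (Multiset.mem_toFinset.1 a.2)
    have hdvd := minpoly.dvd k T (LinearMap.ker_eq_top.1 ha)
    have hmul := mul_divByMonic_eq_iff_isRoot.2 hroot
    have hne : f /ₘ (X - C (a : k)) ≠ 0 := by
      intro h0
      rw [h0, mul_zero] at hmul
      exact hf0 hmul.symm
    have h1 := natDegree_le_of_dvd hdvd hne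
    have h2 := congrArg natDegree hmul
    rw [natDegree_mul (X_sub_C_ne_zero _) hne, natDegree_X_sub_C] at h2
    rw [← hf] at h1
    omega
  refine ⟨v, fun p hp => ?_⟩
  have hfv : aeval T f v = 0 := by rw [hf, minpoly.aeval]; rfl
  have hd : aeval T (EuclideanDomain.gcd p f) v = 0 := by
    rw [EuclideanDomain.gcd_eq_gcd_ab, mul_comm p, mul_comm f]
    simp [hp, hfv]
  obtain ⟨e, he⟩ := EuclideanDomain.gcd_dvd_right p f
  by_cases hu : IsUnit e
  · rw [he, hu.mul_right_dvd]
    exact EuclideanDomain.gcd_dvd_left p f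
  · have hdeg : e.degree ≠ 0 := fun h => hu (isUnit_iff_degree_eq_zero.2 h)
    obtain ⟨a, ha⟩ := IsAlgClosed.exists_root e hdeg
    obtain ⟨c, rfl⟩ := dvd_iff_isRoot.2 ha
    have hfa : f = (X - C a) * (c * EuclideanDomain.gcd p f) :=
      he.trans (by ring)
    have hmem : a ∈ f.roots.toFinset := by
      rw [Multiset.mem_toFinset, mem_roots hf0, ← dvd_iff_isRoot]
      exact ⟨_, hfa⟩
    refine absurd ?_ (hv ⟨a, hmem⟩)
    have : f /ₘ (X - C a) = c * EuclideanDomain.gcd p f := by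
      conv_lhs => rw [hfa]
      exact mul_divByMonic_cancel_left _ (monic_X_sub_C a)
    simp only [this, map_mul, Module.End.mul_apply, hd, map_zero]

open Polynomial in
/-- A vector annihilated only by multiples of a minimal polynomial of full degree is cyclic. -/
theorem Module.End.surjective_aeval_apply_of_minpoly_dvd {k V : Type*} [Field k]
    [AddCommGroup V] [Module k V] [FiniteDimensional k V] {T : Module.End k V}
    (hdeg : (minpoly k T).natDegree = Module.finrank k V) {v : V}
    (hv : ∀ p : k[X], aeval T p v = 0 → minpoly k T ∣ p) (w : V) : ∃ p : k[X], aeval T p v = w := by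
  let φ : k[X] →ₗ[k] V := (LinearMap.applyₗ v).comp (aeval T).toLinearMap
  let ψ : degreeLT k (Module.finrank k V) →ₗ[k] V := φ.comp (degreeLT k _).subtype
  have hfin : Module.finrank k (degreeLT k (Module.finrank k V)) = Module.finrank k V := by
    rw [(degreeLTEquiv k _).finrank_eq, Module.finrank_fin_fun]
  have : FiniteDimensional k (degreeLT k (Module.finrank k V)) :=
    (degreeLTEquiv k (Module.finrank k V)).symm.finiteDimensional
  have hinj : Function.Injective ψ := by
    rw [injective_iff_map_eq_zero]
    rintro ⟨p, hp⟩ h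
    have hdvd := hv p h
    rw [mem_degreeLT, ← hdeg] at hp
    refine Subtype.ext (eq_zero_of_dvd_of_degree_lt hdvd (hp.trans_le ?_))
    exact (degree_eq_natDegree (minpoly.ne_zero (Algebra.IsIntegral.isIntegral T))).ge
  obtain ⟨p, hp⟩ := (LinearMap.injective_iff_surjective_of_finrank_eq_finrank hfin).1 hinj w
  exact ⟨p, hp⟩

open Polynomial in
/-- Regular endomorphisms with the same minimal polynomial are conjugate. -/
theorem Module.End.exists_linearEquiv_of_minpoly_eq {k V : Type*} [Field k] [IsAlgClosed k]
    [AddCommGroup V] [Module k V] [FiniteDimensional k V] {T T' : Module.End k V}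
    (hdeg : (minpoly k T).natDegree = Module.finrank k V) (h : minpoly k T = minpoly k T') :
    ∃ e : V ≃ₗ[k] V, ∀ w, e (T w) = T' (e w) := by
  obtain ⟨v, hv⟩ := exists_minpoly_dvd_of_aeval_apply_eq_zero T
  obtain ⟨v', hv'⟩ := exists_minpoly_dvd_of_aeval_apply_eq_zero T'
  let φ : k[X] →ₗ[k] V := (LinearMap.applyₗ v).comp (aeval T).toLinearMap
  let φ' : k[X] →ₗ[k] V := (LinearMap.applyₗ v').comp (aeval T').toLinearMap
  have hφ : Function.Surjective φ := surjective_aeval_apply_of_minpoly_dvd hdeg hv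
  have hφ' : Function.Surjective φ' := surjective_aeval_apply_of_minpoly_dvd (h ▸ hdeg) hv'
  have hker : LinearMap.ker φ = LinearMap.ker φ' := by
    ext p
    refine ⟨fun hp => ?_, fun hp => ?_⟩
    · have := minpoly.dvd_iff.1 (h ▸ hv p hp)
      simp [φ', this]
    · have := minpoly.dvd_iff.1 (h ▸ hv' p hp)
      simp [φ, this]
  let e : V ≃ₗ[k] V := (φ.quotKerEquivOfSurjective hφ).symm ≪≫ₗ
    Submodule.quotEquivOfEq _ _ hker ≪≫ₗ φ'.quotKerEquivOfSurjective hφ'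
  have he : ∀ p, e (φ p) = φ' p := by
    intro p
    have : (φ.quotKerEquivOfSurjective hφ).symm (φ p) = Submodule.Quotient.mk p := by
      rw [LinearEquiv.symm_apply_eq, LinearMap.quotKerEquivOfSurjective_apply_mk]
    simp only [e, LinearEquiv.trans_apply, this, Submodule.quotEquivOfEq_mk,
      LinearMap.quotKerEquivOfSurjective_apply_mk]
  refine ⟨e, fun w => ?_⟩
  obtain ⟨p, rfl⟩ := hφ w
  have h1 : T (φ p) = φ (X * p) := by simp [φ]
  have h2 : T' (φ' p) = φ' (X * p) := by simp [φ']
  rw [h1, he, he, h2]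

/-- Regular matrices with the same characteristic polynomial are conjugate. -/
theorem Matrix.exists_isUnit_mul_eq_mul_of_charpoly_eq {k n : Type*} [Field k] [IsAlgClosed k]
    [Fintype n] [DecidableEq n] {T T' : Matrix n n k} (hT : minpoly k T = T.charpoly)
    (hT' : minpoly k T' = T'.charpoly) (h : T.charpoly = T'.charpoly) :
    ∃ g : Matrix n n k, IsUnit g ∧ g * T = T' * g := by
  obtain ⟨e, he⟩ := Module.End.exists_linearEquiv_of_minpoly_eq (T := toLin' T) (T' := toLin' T')
    (by rw [minpoly_toLin', hT, charpoly_natDegree_eq_dim, Module.finrank_fintype_fun_eq_card])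
    (by rw [minpoly_toLin', minpoly_toLin', hT, hT', h])
  refine ⟨LinearMap.toMatrix' e.toLinearMap, ?_, ?_⟩
  · rw [← isUnit_toLin'_iff, toLin'_toMatrix']
    exact (Module.End.isUnit_iff _).2 e.bijective
  · apply toLin'.injective
    rw [toLin'_mul, toLin'_mul, toLin'_toMatrix']
    exact LinearMap.ext he

/-- **Regular self-adjoint matrices with equal characteristic polynomial are
`O(J)`-conjugate.**
Let `k` be an algebraically closed field of characteristic `≠ 2`, `m ≥ 1`,
and `J` a symmetric invertible `m × m` matrix over `k`. If `T`, `T'` are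
self-adjoint with respect to `J` (`M* = J⁻¹ * Mᵀ * J`), regular (minimal
polynomial = characteristic polynomial), and have the same characteristic
polynomial, then `T' = h * T * h⁻¹` for some `h` in the orthogonal group
`O(J)(k)`. -/
theorem regular_selfadjoint_orthogonal_conjugate
    (k : Type) [Field k] [IsAlgClosed k] (hk : ringChar k ≠ 2)
    (m : ℕ) (hm : 1 ≤ m)
    (J : Matrix (Fin m) (Fin m) k) (hJsymm : Jᵀ = J) (hJ : IsUnit J)
    (T T' : Matrix (Fin m) (Fin m) k)
    (hT : J⁻¹ * Tᵀ * J = T) (hT' : J⁻¹ * T'ᵀ * J = T')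
    (hTreg : minpoly k T = T.charpoly) (hT'reg : minpoly k T' = T'.charpoly)
    (hcp : T.charpoly = T'.charpoly) :
    ∃ h : Matrix (Fin m) (Fin m) k,
      IsUnit h ∧ hᵀ * J * h = J ∧ T' = h * T * h⁻¹ := by
  have h2 : (2 : k) ≠ 0 := Ring.two_ne_zero hk
  obtain ⟨g, hg, hgT⟩ := exists_isUnit_mul_eq_mul_of_charpoly_eq hTreg hT'reg hcp
  have hJd := (isUnit_iff_isUnit_det J).1 hJ
  have hTJ : Tᵀ * J = J * T := by
    conv_rhs => rw [← hT]
    rw [Matrix.mul_assoc, mul_nonsing_inv_cancel_left _ _ hJd]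
  have hTJ' : T'ᵀ * J = J * T' := by
    conv_rhs => rw [← hT']
    rw [Matrix.mul_assoc, mul_nonsing_inv_cancel_left _ _ hJd]
  set S := J⁻¹ * (gᵀ * J * g)
  have hJS : J * S = gᵀ * J * g := mul_nonsing_inv_cancel_left _ _ hJd
  have hS : IsUnit S :=
    ((isUnit_nonsing_inv_iff).2 hJ).mul
      ((((isUnit_transpose _).2 hg).mul hJ).mul hg)
  have hSJ : Sᵀ * J = J * S := by
    have : (J * S)ᵀ = J * S := by
      rw [hJS]
      simp only [transpose_mul, transpose_transpose, hJsymm, Matrix.mul_assoc]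
    rwa [transpose_mul, hJsymm] at this
  have hcomm : Commute S T := by
    apply hJ.mul_left_cancel
    calc J * (S * T) = gᵀ * J * (g * T) := by rw [← Matrix.mul_assoc, hJS, Matrix.mul_assoc]
      _ = gᵀ * (T'ᵀ * J) * g := by rw [hgT, hTJ']; simp only [Matrix.mul_assoc]
      _ = (T' * g)ᵀ * J * g := by rw [transpose_mul]; simp only [Matrix.mul_assoc]
      _ = Tᵀ * (gᵀ * J * g) := by rw [← hgT, transpose_mul]; simp only [Matrix.mul_assoc]
      _ = J * (T * S) := by rw [← hJS, ← Matrix.mul_assoc, hTJ, Matrix.mul_assoc]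
  obtain ⟨q, hq⟩ := exists_aeval_sq_eq h2 hS
  set Q := Polynomial.aeval S q with hQ
  have hQT : Commute Q T := by
    rw [hQ, Polynomial.aeval_eq_sum_range]
    exact Commute.sum_left _ _ _ fun i _ => (hcomm.pow_left i).smul_left _
  have hQJ : Qᵀ * J = J * Q := by
    have hpow : ∀ i : ℕ, (S ^ i)ᵀ * J = J * S ^ i := by
      intro i
      have : SemiconjBy J S Sᵀ := hSJ.symm
      rw [transpose_pow]
      exact (this.pow_right i).symm
    rw [hQ, Polynomial.aeval_eq_sum_range, transpose_sum, Finset.sum_mul, Finset.mul_sum]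
    refine Finset.sum_congr rfl fun i _ => ?_
    rw [transpose_smul, Matrix.smul_mul, Matrix.mul_smul, hpow]
  have hQu : IsUnit Q := (isUnit_pow_iff two_ne_zero).1 (hq ▸ hS)
  have hQd := (isUnit_iff_isUnit_det Q).1 hQu
  have hgd := (isUnit_iff_isUnit_det g).1 hg
  have hQQ : Qᵀ * J * Q = gᵀ * J * g := by
    rw [hQJ, Matrix.mul_assoc, ← sq, hq, hJS]
  refine ⟨g * Q⁻¹, hg.mul (isUnit_nonsing_inv_iff.2 hQu), ?_, ?_⟩
  · have hQt : (Q⁻¹)ᵀ * Qᵀ = 1 := by rw [← transpose_mul, mul_nonsing_inv _ hQd, transpose_one]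
    calc (g * Q⁻¹)ᵀ * J * (g * Q⁻¹) = (Q⁻¹)ᵀ * (gᵀ * J * g) * Q⁻¹ := by
          rw [transpose_mul]; simp only [Matrix.mul_assoc]
      _ = ((Q⁻¹)ᵀ * Qᵀ) * J * (Q * Q⁻¹) := by rw [← hQQ]; simp only [Matrix.mul_assoc]
      _ = J := by rw [hQt, mul_nonsing_inv _ hQd, Matrix.one_mul, Matrix.mul_one]
  · have hQiT : Q⁻¹ * T * Q = T := by
      rw [Matrix.mul_assoc, ← hQT.eq, nonsing_inv_mul_cancel_left _ _ hQd]
    rw [Matrix.mul_inv_rev, nonsing_inv_nonsing_inv _ hQd]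
    calc T' = T' * g * g⁻¹ := (mul_nonsing_inv_cancel_right _ _ hgd).symm
      _ = g * (Q⁻¹ * T * Q) * g⁻¹ := by rw [hQiT, hgT]
      _ = g * Q⁻¹ * T * (Q * g⁻¹) := by simp only [Matrix.mul_assoc]
end

section
/- Let k be an algebraically closed field with char(k) ≠ 2, m ≥ 1, and J ∈ GL_m(k) a symmetric invertible matrix. Suppose T, T′ ∈ M_m(k) are self-adjoint with respect to J, both regular (minimal polynomial equals characteristic polynomial), with the same characteristic polynomial f, and suppose furthermore that f is NOT the square of a polynomial in k[x] (equivalently, f has a root of odd multiplicity). Then there exists h ∈ SO(J)(k) (i.e., hᵀ J h = J and det h = 1) with T′ = h T h⁻¹. -/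
open Matrix
open Polynomial

namespace Matrix

variable {k : Type*} [Field k] {m : ℕ}

theorem det_aeval_eq_prod_eval_roots_charpoly [IsAlgClosed k] (T : Matrix (Fin m) (Fin m) k)
    (q : k[X]) : (aeval T q).det = (T.charpoly.roots.map fun a => q.eval a).prod := by
  have hcard : T.charpoly.roots.card = m := by
    rw [← (IsAlgClosed.splits T.charpoly).natDegree_eq_card_roots, charpoly_natDegree_eq_dim,
      Fintype.card_fin]
  have hlin (b : k) : (aeval T (X - C b)).det =
      (T.charpoly.roots.map fun a => (X - C b).eval a).prod := by
    have h := eval_charpoly T b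
    rw [(IsAlgClosed.splits T.charpoly).eval_eq_prod_roots_of_monic T.charpoly_monic] at h
    have h2 : aeval T (X - C b) = -(scalar (Fin m) b - T) := by
      simp [Matrix.algebraMap_eq_diagonal, Matrix.scalar_apply, Pi.algebraMap_def]
    rw [h2, det_neg, ← h, Fintype.card_fin]
    have h3 := Multiset.prod_map_neg (T.charpoly.roots.map fun a => b - a)
    rw [Multiset.card_map, hcard] at h3
    rw [← h3, Multiset.map_map]
    simp
  rw [(IsAlgClosed.splits q).eq_prod_roots]
  generalize q.roots = s
  induction s using Multiset.induction with
  | empty =>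
    simp [hcard, Matrix.algebraMap_eq_diagonal]
  | cons b s ih =>
    rw [Multiset.map_cons, Multiset.prod_cons, mul_left_comm, map_mul, det_mul, ih, hlin,
      ← Multiset.prod_map_mul]
    simp only [eval_mul]

theorem exists_forall_aeval_mulVec_eq_zero [IsAlgClosed k]
    (T : Matrix (Fin m) (Fin m) k) (hT : minpoly k T = T.charpoly) :
    ∃ v : Fin m → k, ∀ p : k[X], p.natDegree < m → aeval T p *ᵥ v = 0 → p = 0 := by
  classical
  let K (a : k) : Submodule k (Fin m → k) :=
    LinearMap.ker (mulVecLin (aeval T (T.charpoly /ₘ (X - C a))))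
  have hne : T.charpoly ≠ 0 := T.charpoly_monic.ne_zero
  have htop : ⊤ ∉ T.charpoly.roots.toFinset.image K := by
    intro h
    obtain ⟨a, ha, h⟩ := Finset.mem_image.1 h
    rw [Multiset.mem_toFinset] at ha
    have hr : T.charpoly.IsRoot a := (mem_roots'.1 ha).2
    have hf := mul_divByMonic_eq_iff_isRoot.2 hr
    have h0 : aeval T (T.charpoly /ₘ (X - C a)) = 0 := by
      refine toLin'.injective ?_
      rw [map_zero]
      exact LinearMap.ker_eq_top.1 h
    have hd := minpoly.dvd k T h0
    rw [hT] at hd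
    have h1 : T.charpoly /ₘ (X - C a) ≠ 0 := by
      intro h1; rw [h1, mul_zero] at hf; exact hne hf.symm
    have h2 := natDegree_le_of_dvd hd h1
    rw [natDegree_divByMonic _ (monic_X_sub_C a), natDegree_X_sub_C] at h2
    have h3 : 0 < T.charpoly.natDegree := natDegree_pos_iff_degree_pos.2
      (degree_pos_of_root hne hr)
    omega
  obtain ⟨v, hv⟩ := (Set.ne_univ_iff_exists_notMem _).1
    (Subspace.biUnion_ne_univ_of_top_notMem htop)
  refine ⟨v, fun p hp hpv => ?_⟩
  by_contra hp0
  let I : Ideal k[X] :=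
    { carrier := {q | aeval T q *ᵥ v = 0}
      add_mem' := fun {a b} ha hb => by
        simp only [Set.mem_ofPred_eq] at *
        rw [map_add, add_mulVec, ha, hb, add_zero]
      zero_mem' := by simp
      smul_mem' := fun c x hx => by
        simp only [Set.mem_ofPred_eq] at *
        rw [smul_eq_mul, map_mul, ← mulVec_mulVec, hx, mulVec_zero] }
  obtain ⟨g, hg⟩ := (IsPrincipalIdealRing.principal I).principal
  have hmem (q : k[X]) : aeval T q *ᵥ v = 0 ↔ g ∣ q := by
    change q ∈ I ↔ _
    rw [hg]; exact Ideal.mem_span_singleton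
  have hgf : g ∣ T.charpoly := (hmem _).1 (by rw [aeval_self_charpoly, zero_mulVec])
  obtain ⟨w, hw⟩ := hgf
  have hwdeg : 0 < w.degree := by
    rw [← natDegree_pos_iff_degree_pos]
    have h1 := natDegree_le_of_dvd ((hmem p).1 hpv) hp0
    have h2 := congrArg natDegree hw
    rw [charpoly_natDegree_eq_dim, Fintype.card_fin, natDegree_mul] at h2
    · omega
    · rintro rfl; simp at hw; exact hne hw
    · rintro rfl; simp at hw; exact hne hw
  obtain ⟨a, ha⟩ := IsAlgClosed.exists_root w hwdeg.ne'
  have har : T.charpoly.IsRoot a := by rw [hw]; exact root_mul_left_of_isRoot _ ha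
  have hf := mul_divByMonic_eq_iff_isRoot.2 har
  have hwf := mul_divByMonic_eq_iff_isRoot.2 ha
  have hdvd : g ∣ T.charpoly /ₘ (X - C a) := by
    refine ⟨w /ₘ (X - C a), ?_⟩
    apply mul_left_cancel₀ (X_sub_C_ne_zero a)
    rw [hf, mul_left_comm, hwf, hw]
  apply hv
  simp only [Set.mem_iUnion]
  exact ⟨K a, Finset.mem_image_of_mem K (Multiset.mem_toFinset.2 ((mem_roots hne).2 har)),
    by simpa [K] using (hmem _).2 hdvd⟩

/-- The matrix whose columns are `v, T v, T² v, …`. -/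
def krylov (T : Matrix (Fin m) (Fin m) k) (v : Fin m → k) : Matrix (Fin m) (Fin m) k :=
  of fun i j => ((T ^ (j : ℕ)) *ᵥ v) i

theorem krylov_mulVec (T : Matrix (Fin m) (Fin m) k) (v c : Fin m → k) :
    krylov T v *ᵥ c = aeval T (∑ i : Fin m, C (c i) * X ^ (i : ℕ)) *ᵥ v := by
  rw [map_sum, sum_mulVec]
  ext i
  simp only [mulVec, dotProduct, krylov, of_apply, Finset.sum_apply]
  refine Finset.sum_congr rfl fun j _ => ?_
  rw [map_mul, aeval_C, map_pow, aeval_X, ← Algebra.smul_def]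
  change (T ^ (j : ℕ) *ᵥ v) i * c j = ((c j • T ^ (j : ℕ)) *ᵥ v) i
  rw [smul_mulVec, Pi.smul_apply, smul_eq_mul, mul_comm]

theorem isUnit_krylov (T : Matrix (Fin m) (Fin m) k) (v : Fin m → k)
    (hv : ∀ p : k[X], p.natDegree < m → aeval T p *ᵥ v = 0 → p = 0) :
    IsUnit (krylov T v) := by
  rw [← mulVec_injective_iff_isUnit]
  refine (injective_iff_map_eq_zero (krylov T v).mulVecLin).2 fun c hc => ?_
  rw [mulVecLin_apply, krylov_mulVec] at hc
  ext i
  have hm : 0 < m := i.pos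
  have h := hv _ (by
    refine lt_of_le_of_lt (natDegree_sum_le_of_forall_le (n := m - 1) _ _ fun j _ => ?_)
      (by omega)
    exact (natDegree_C_mul_X_pow_le _ _).trans (by omega)) hc
  have h2 := congrArg (fun p => coeff p (i : ℕ)) h
  simpa [finsetSum_coeff, coeff_X_pow, Fin.val_inj] using h2

/-- The companion matrix of a polynomial of degree `m`. -/
noncomputable def companionOf (m : ℕ) (f : k[X]) : Matrix (Fin m) (Fin m) k :=
  of fun i j => (X ^ ((j : ℕ) + 1) %ₘ f).coeff i

theorem mul_krylov (T : Matrix (Fin m) (Fin m) k) (v : Fin m → k) :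
    T * krylov T v = krylov T v * companionOf m T.charpoly := by
  ext i j
  have h := congrFun (krylov_mulVec T v fun l => companionOf m T.charpoly l j) i
  have hp : ∑ l : Fin m, C (companionOf m T.charpoly l j) * X ^ (l : ℕ) =
      X ^ ((j : ℕ) + 1) %ₘ T.charpoly := by
    simp only [C_mul_X_pow_eq_monomial]
    exact sum_modByMonic_coeff T.charpoly_monic (n := m) (by
      simp [charpoly_degree_eq_dim])
  rw [hp, ← pow_eq_aeval_mod_charpoly, pow_succ', ← mulVec_mulVec] at h
  exact h.symm

theorem commute_aeval_self (T : Matrix (Fin m) (Fin m) k) (p : k[X]) : Commute (aeval T p) T := by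
  simpa using (Commute.all p X).map (aeval T)

theorem exists_aeval_eq_of_commute (T S : Matrix (Fin m) (Fin m) k) (v : Fin m → k)
    (hV : IsUnit (krylov T v)) (hS : Commute S T) : ∃ p : k[X], aeval T p = S := by
  obtain ⟨c, hc⟩ := mulVec_surjective_iff_isUnit.2 hV (S *ᵥ v)
  rw [krylov_mulVec] at hc
  refine ⟨∑ i : Fin m, C (c i) * X ^ (i : ℕ), hV.mul_right_cancel ?_⟩
  generalize (∑ i : Fin m, C (c i) * X ^ (i : ℕ) : k[X]) = p at hc ⊢
  ext i j
  have h1 : aeval T p *ᵥ (T ^ (j : ℕ) *ᵥ v) = S *ᵥ (T ^ (j : ℕ) *ᵥ v) := by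
    rw [mulVec_mulVec, mulVec_mulVec, (hS.pow_right _).eq, ← mulVec_mulVec _ _ S, ← hc,
      mulVec_mulVec, ((commute_aeval_self T p).pow_right _).eq]
  exact congrFun h1 i

end Matrix

theorem Polynomial.exists_dvd_sub_sq {k : Type*} [Field k] [IsAlgClosed k] (h2 : (2 : k) ≠ 0)
    (p : k[X]) (s : Multiset k) (hp : ∀ a ∈ s, p.eval a ≠ 0) :
    ∃ q : k[X], (s.map fun a => X - C a).prod ∣ p - q ^ 2 := by
  induction s using Multiset.induction with
  | empty => exact ⟨0, by simp⟩
  | cons a s ih =>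
    obtain ⟨q, u, hu⟩ := ih fun b hb => hp b (Multiset.mem_cons_of_mem hb)
    rw [Multiset.map_cons, Multiset.prod_cons]
    generalize (s.map fun a => X - C a).prod = f at hu ⊢
    have hpa := hp a (Multiset.mem_cons_self a s)
    suffices ∃ c : k, (u - 2 * C c * q - C c ^ 2 * f).eval a = 0 by
      obtain ⟨c, hc⟩ := this
      obtain ⟨w, hw⟩ := dvd_iff_isRoot.2 hc
      refine ⟨q + C c * f, w, ?_⟩
      linear_combination hu + f * hw
    have hu' := congrArg (eval a) hu
    simp only [eval_sub, eval_pow, eval_mul] at hu'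
    by_cases hf : f.eval a = 0
    · have hq : q.eval a ≠ 0 := by
        intro hq
        simp [hf, hq] at hu'
        exact hpa hu'
      refine ⟨u.eval a / (2 * q.eval a), ?_⟩
      simp [hf]
      field_simp
      ring
    · obtain ⟨r, hr⟩ := IsAlgClosed.exists_pow_nat_eq (p.eval a) (n := 2) two_pos
      refine ⟨(r - q.eval a) / f.eval a, ?_⟩
      apply mul_left_cancel₀ hf
      simp only [eval_sub, eval_mul, eval_pow, eval_C, eval_ofNat, mul_zero]
      field_simp
      linear_combination -hu' - hr

theorem Polynomial.exists_odd_rootMultiplicity {k : Type*} [Field k] [IsAlgClosed k] {f : k[X]}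
    (hf : f.Monic) (hsq : ¬ ∃ g : k[X], f = g ^ 2) : ∃ a, Odd (f.rootMultiplicity a) := by
  classical
  by_contra! h
  simp only [Nat.not_odd_iff_even] at h
  apply hsq
  refine ⟨∏ a ∈ f.roots.toFinset, (X - C a) ^ (f.rootMultiplicity a / 2), ?_⟩
  conv_lhs => rw [(IsAlgClosed.splits f).eq_prod_roots_of_monic hf]
  rw [Finset.prod_multiset_map_count, ← Finset.prod_pow]
  refine Finset.prod_congr rfl fun a _ => ?_
  rw [← pow_mul, count_roots, Nat.div_mul_cancel (h a).two_dvd]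

theorem Matrix.exists_aeval_sq_eq_one_and_det_eq_neg_one {k : Type*} [Field k] [IsAlgClosed k]
    {m : ℕ} (T : Matrix (Fin m) (Fin m) k) (hsq : ¬ ∃ g : k[X], T.charpoly = g ^ 2) :
    ∃ s : k[X], aeval T s * aeval T s = 1 ∧ (aeval T s).det = -1 := by
  classical
  obtain ⟨a, ha⟩ := exists_odd_rootMultiplicity T.charpoly_monic hsq
  have hne : T.charpoly ≠ 0 := T.charpoly_monic.ne_zero
  obtain ⟨w, hw, hwa⟩ := exists_eq_pow_rootMultiplicity_mul_and_not_dvd T.charpoly hne a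
  set r := T.charpoly.rootMultiplicity a with hr
  have hcop : IsCoprime ((X - C a) ^ r) w :=
    ((irreducible_X_sub_C a).coprime_iff_not_dvd.2 hwa).pow_left
  obtain ⟨u, v, huv⟩ := hcop
  refine ⟨1 - 2 * (v * w), ?_, ?_⟩
  · have h : (1 - 2 * (v * w)) * (1 - 2 * (v * w)) = 1 - T.charpoly * (4 * u * v) := by
      rw [hw]
      linear_combination (4 * v * w) * huv
    rw [← map_mul, h, map_sub, map_mul, aeval_self_charpoly, zero_mul, sub_zero, map_one]
  · rw [det_aeval_eq_prod_eval_roots_charpoly]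
    have h : T.charpoly.roots.map (fun b => (1 - 2 * (v * w)).eval b) =
        T.charpoly.roots.map (fun b => if b = a then -1 else 1) := by
      refine Multiset.map_congr rfl fun b hb => ?_
      have hb' : T.charpoly.eval b = 0 := (mem_roots'.1 hb).2
      have huv' := congrArg (eval b) huv
      simp only [eval_add, eval_mul, eval_pow, eval_sub, eval_X, eval_C, eval_one] at huv'
      split_ifs with hba
      · subst hba
        rw [sub_self, zero_pow ha.pos.ne'] at huv'
        simp only [eval_sub, eval_mul, eval_one, eval_ofNat]
        linear_combination -2 * huv'
      · have : w.eval b = 0 := by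
          rw [hw] at hb'
          simpa [sub_eq_zero, hba] using hb'
        simp [this]
    rw [h, Finset.prod_multiset_map_count, Finset.prod_eq_single a]
    · rw [if_pos rfl, count_roots, ← hr, ha.neg_one_pow]
    · intro b _ hb
      simp [hb]
    · intro h
      rw [count_roots, ← hr, if_pos rfl, ha.neg_one_pow]
      rw [Multiset.mem_toFinset, ← Multiset.count_eq_zero, count_roots, ← hr] at h
      simp [h] at ha

theorem Matrix.transpose_aeval_mul {k : Type*} [Field k] {m : ℕ}
    {J T : Matrix (Fin m) (Fin m) k} (hT : Tᵀ * J = J * T) (p : k[X]) :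
    (aeval T p)ᵀ * J = J * aeval T p := by
  induction p using Polynomial.induction_on' with
  | add p q hp hq => rw [map_add, transpose_add, add_mul, mul_add, hp, hq]
  | monomial n a =>
    have h (n : ℕ) : (T ^ n)ᵀ * J = J * T ^ n := by
      induction n with
      | zero => simp
      | succ n ih =>
        rw [pow_succ, transpose_mul, Matrix.mul_assoc, ih, ← Matrix.mul_assoc, hT,
          Matrix.mul_assoc, ← pow_succ', ← pow_succ]
    rw [aeval_monomial, ← Algebra.smul_def, transpose_smul, smul_mul, h, Matrix.mul_smul]

/-- **`SO(J)`-conjugacy when the characteristic polynomial is not a square.**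
Let `k` be an algebraically closed field of characteristic `≠ 2`, `m ≥ 1`,
and `J` a symmetric invertible `m × m` matrix over `k`. If `T`, `T'` are
self-adjoint with respect to `J`, regular (minimal polynomial = characteristic
polynomial), with the same characteristic polynomial `f`, and `f` is not the
square of a polynomial in `k[x]`, then `T' = h * T * h⁻¹` for some `h` in the
special orthogonal group `SO(J)(k)`. -/
theorem regular_selfadjoint_special_orthogonal_conjugate
    (k : Type) [Field k] [IsAlgClosed k] (hk : ringChar k ≠ 2)
    (m : ℕ) (hm : 1 ≤ m)
    (J : Matrix (Fin m) (Fin m) k) (hJsymm : Jᵀ = J) (hJ : IsUnit J)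
    (T T' : Matrix (Fin m) (Fin m) k)
    (hT : J⁻¹ * Tᵀ * J = T) (hT' : J⁻¹ * T'ᵀ * J = T')
    (hTreg : minpoly k T = T.charpoly) (hT'reg : minpoly k T' = T'.charpoly)
    (hcp : T.charpoly = T'.charpoly)
    (hnotsq : ¬ ∃ g : Polynomial k, T.charpoly = g ^ 2) :
    ∃ h : Matrix (Fin m) (Fin m) k,
      hᵀ * J * h = J ∧ h.det = 1 ∧ T' = h * T * h⁻¹ := by
  have h2 : (2 : k) ≠ 0 := Ring.two_ne_zero hk
  have hJdet : IsUnit J.det := (isUnit_iff_isUnit_det J).1 hJ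
  have hTJ : Tᵀ * J = J * T := by
    conv_rhs => rw [← hT]
    rw [Matrix.mul_assoc, mul_nonsing_inv_cancel_left _ _ hJdet]
  have hTJ' : T'ᵀ * J = J * T' := by
    conv_rhs => rw [← hT']
    rw [Matrix.mul_assoc, mul_nonsing_inv_cancel_left _ _ hJdet]
  obtain ⟨v, hv⟩ := exists_forall_aeval_mulVec_eq_zero T hTreg
  obtain ⟨v', hv'⟩ := exists_forall_aeval_mulVec_eq_zero T' hT'reg
  have hV := isUnit_krylov T v hv
  have hV' := isUnit_krylov T' v' hv'
  have hTV := mul_krylov T v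
  have hTV' := mul_krylov T' v'
  rw [← hcp] at hTV'
  obtain ⟨g, hg, hgT⟩ : ∃ g : Matrix (Fin m) (Fin m) k, IsUnit g ∧ g * T = T' * g := by
    have hVd := (isUnit_iff_isUnit_det _).1 hV
    refine ⟨krylov T' v' * (krylov T v)⁻¹, hV'.mul (isUnit_nonsing_inv_iff.2 hV), ?_⟩
    apply hV.mul_right_cancel
    rw [Matrix.mul_assoc, hTV, ← Matrix.mul_assoc T', hTV', Matrix.mul_assoc, Matrix.mul_assoc,
      nonsing_inv_mul_cancel_left _ _ hVd, Matrix.mul_assoc, nonsing_inv_mul _ hVd, Matrix.mul_one]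
  -- `g* g` commutes with `T`, hence is a polynomial in `T`, and so is its square root
  have hgT' : gᵀ * T'ᵀ = Tᵀ * gᵀ := by rw [← transpose_mul, ← hgT, transpose_mul]
  obtain ⟨p, hp⟩ := exists_aeval_eq_of_commute T (J⁻¹ * (gᵀ * J * g)) v hV (by
    apply hJ.mul_left_cancel
    rw [← Matrix.mul_assoc, mul_nonsing_inv_cancel_left _ _ hJdet]
    calc gᵀ * J * g * T = gᵀ * (J * T') * g := by
          simp only [Matrix.mul_assoc, hgT]
      _ = Tᵀ * (gᵀ * J * g) := by
          rw [← hTJ', ← Matrix.mul_assoc gᵀ, hgT']; simp only [Matrix.mul_assoc]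
      _ = Tᵀ * J * (J⁻¹ * (gᵀ * J * g)) := by
          rw [Matrix.mul_assoc Tᵀ, mul_nonsing_inv_cancel_left _ _ hJdet]
      _ = J * (T * (J⁻¹ * (gᵀ * J * g))) := by rw [hTJ, Matrix.mul_assoc])
  have hgd := (isUnit_iff_isUnit_det g).1 hg
  have hpdet : (aeval T p).det ≠ 0 := by
    rw [hp]
    simp only [det_mul, det_transpose]
    exact mul_ne_zero (isUnit_nonsing_inv_det J hJdet).ne_zero
      (mul_ne_zero (mul_ne_zero hgd.ne_zero hJdet.ne_zero) hgd.ne_zero)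
  obtain ⟨q, hq⟩ := exists_dvd_sub_sq h2 p T.charpoly.roots fun a ha h0 => hpdet <| by
    rw [det_aeval_eq_prod_eval_roots_charpoly]
    exact Multiset.prod_eq_zero (Multiset.mem_map.2 ⟨a, ha, h0⟩)
  rw [← (IsAlgClosed.splits T.charpoly).eq_prod_roots_of_monic T.charpoly_monic] at hq
  obtain ⟨w, hw⟩ := hq
  have hR2 : aeval T q * aeval T q = aeval T p := by
    rw [← map_mul, ← sub_eq_zero, ← map_sub,
      show q * q - p = T.charpoly * -w by linear_combination -hw, map_mul, aeval_self_charpoly,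
      zero_mul]
  have hRJ := transpose_aeval_mul hTJ q
  have hRT : aeval T q * T = T * aeval T q := (commute_aeval_self T q).eq
  generalize aeval T q = R at hR2 hRJ hRT
  have hRd : IsUnit R.det := by
    rw [isUnit_iff_ne_zero]
    intro h
    apply hpdet
    rw [← hR2, det_mul, h, zero_mul]
  have hRi : R⁻¹ * R = 1 := nonsing_inv_mul R hRd
  have hRi' : R * R⁻¹ = 1 := mul_nonsing_inv R hRd
  have hgJ : gᵀ * J * g = Rᵀ * J * R := by
    rw [hRJ, Matrix.mul_assoc J, hR2, hp, mul_nonsing_inv_cancel_left _ _ hJdet]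
  have key : ∃ h : Matrix (Fin m) (Fin m) k, hᵀ * J * h = J ∧ h * T = T' * h := by
    refine ⟨g * R⁻¹, ?_, ?_⟩
    · calc (g * R⁻¹)ᵀ * J * (g * R⁻¹) = R⁻¹ᵀ * (gᵀ * J * g) * R⁻¹ := by
            rw [transpose_mul]; simp only [Matrix.mul_assoc]
        _ = (R * R⁻¹)ᵀ * J * (R * R⁻¹) := by
            rw [hgJ, transpose_mul]; simp only [Matrix.mul_assoc]
        _ = J := by rw [hRi', transpose_one, Matrix.one_mul, Matrix.mul_one]
    · have hRiT : R⁻¹ * T = T * R⁻¹ := by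
        calc R⁻¹ * T = R⁻¹ * (T * R) * R⁻¹ := by
              simp only [Matrix.mul_assoc, hRi', Matrix.mul_one]
          _ = T * R⁻¹ := by rw [← hRT, ← Matrix.mul_assoc, hRi, Matrix.one_mul]
      rw [Matrix.mul_assoc, hRiT, ← Matrix.mul_assoc, hgT, Matrix.mul_assoc]
  obtain ⟨h, hh, hhT⟩ := key
  have hdet : h.det * h.det = 1 := by
    have := congrArg det hh
    rw [det_mul, det_mul, det_transpose] at this
    apply mul_right_cancel₀ hJdet.ne_zero
    linear_combination this
  have conj {h : Matrix (Fin m) (Fin m) k} (hd : h.det = 1) (hhT : h * T = T' * h) :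
      T' = h * T * h⁻¹ := by
    rw [hhT, mul_nonsing_inv_cancel_right _ _ (by rw [hd]; exact isUnit_one)]
  rcases mul_self_eq_one_iff.1 hdet with hd | hd
  · exact ⟨h, hh, hd, conj hd hhT⟩
  -- correct the determinant by a reflection commuting with `T`
  · obtain ⟨s, hs, hsd⟩ := exists_aeval_sq_eq_one_and_det_eq_neg_one T hnotsq
    have hsJ := transpose_aeval_mul hTJ s
    have hsT := (commute_aeval_self T s).eq
    generalize aeval T s = A at hs hsd hsJ hsT
    have hd1 : (h * A).det = 1 := by rw [det_mul, hd, hsd]; ring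
    refine ⟨h * A, ?_, hd1, conj hd1 ?_⟩
    · calc (h * A)ᵀ * J * (h * A) = Aᵀ * (hᵀ * J * h) * A := by
            rw [transpose_mul]; simp only [Matrix.mul_assoc]
        _ = J := by rw [hh, hsJ, Matrix.mul_assoc, hs, Matrix.mul_one]
    · rw [Matrix.mul_assoc, hsT, ← Matrix.mul_assoc, hhT, Matrix.mul_assoc]
end

section
/- Let F be a field with char(F) ≠ 2, m ≥ 1, and J ∈ GL_m(F) a symmetric invertible matrix. Let T ∈ M_m(F) be self-adjoint with respect to J and regular, with characteristic polynomial f (so the minimal polynomial of T equals f and deg f = m). Set L = F[x]/(f). Then the evaluation map u ↦ u(T) (evaluating any polynomial lift of u at T) is a well-defined injective group homomorphism from the group μ_2(L) = {u ∈ L : u² = 1} into GL_m(F), and its image is exactly the stabilizer of T in the orthogonal group: {g ∈ M_m(F) : gᵀ J g = J and g T = T g}. -/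
open Matrix

open Polynomial in
/-- Over a field, every square matrix has a vector whose order is the minimal polynomial. -/
theorem Matrix.exists_minpoly_dvd_of_aeval_mulVec_eq_zero {F n : Type*} [Field F] [Fintype n]
    [DecidableEq n] (T : Matrix n n F) :
    ∃ v : n → F, ∀ p : F[X], aeval T p *ᵥ v = 0 → minpoly F T ∣ p := by
  obtain ⟨x, hx⟩ := Module.exists_ker_toSpanSingleton_eq_annihilator F[X]
    (Module.AEval' (toLin' T))
  obtain ⟨v, rfl⟩ := (Module.AEval'.of _).surjective x
  refine ⟨v, fun p hp ↦ ?_⟩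
  rw [← span_minpoly_eq_annihilator, minpoly_toLin'] at hx
  rw [← Ideal.mem_span_singleton, ← hx, LinearMap.mem_ker, LinearMap.toSpanSingleton_apply,
    ← Module.AEval.of_aeval_smul, LinearEquiv.map_eq_zero_iff, Module.End.smul_def]
  have h : aeval (toLin' T) p = toLin' (aeval T p) :=
    aeval_algHom_apply (toLinAlgEquiv' : Matrix n n F ≃ₐ[F] _) T p
  rw [h, toLin'_apply, hp]

open Polynomial in
/-- A regular matrix has a cyclic vector. -/
theorem Matrix.exists_forall_exists_aeval_mulVec_eq {F n : Type*} [Field F] [Fintype n]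
    [DecidableEq n] {T : Matrix n n F} (hT : minpoly F T = T.charpoly) :
    ∃ v : n → F, ∀ w, ∃ p : F[X], aeval T p *ᵥ v = w := by
  obtain ⟨v, hv⟩ := T.exists_minpoly_dvd_of_aeval_mulVec_eq_zero
  let ev : degreeLT F (Fintype.card n) →ₗ[F] n → F :=
    (mulVecBilin F F).flip v ∘ₗ (aeval T).toLinearMap ∘ₗ (degreeLT F (Fintype.card n)).subtype
  have hinj : Function.Injective ev := by
    refine (injective_iff_map_eq_zero ev).2 fun p hp ↦ Subtype.ext ?_
    have hdvd := hv p hp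
    refine eq_zero_of_dvd_of_degree_lt hdvd ?_
    rw [hT, charpoly_degree_eq_dim]
    exact mem_degreeLT.1 p.2
  have hfin : Module.finrank F (degreeLT F (Fintype.card n)) = Module.finrank F (n → F) := by
    rw [(degreeLTEquiv F (Fintype.card n)).finrank_eq]
    simp
  have : FiniteDimensional F (degreeLT F (Fintype.card n)) :=
    (degreeLTEquiv F (Fintype.card n)).symm.finiteDimensional
  refine ⟨v, fun w ↦ ?_⟩
  obtain ⟨p, hp⟩ := (LinearMap.injective_iff_surjective_of_finrank_eq_finrank hfin).1 hinj w
  exact ⟨p, hp⟩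

open Polynomial in
/-- The centralizer of a regular matrix consists of polynomials in that matrix. -/
theorem Matrix.exists_aeval_eq_of_commute_s10 {F n : Type*} [Field F] [Fintype n] [DecidableEq n]
    {T g : Matrix n n F} (hT : minpoly F T = T.charpoly) (hg : Commute g T) :
    ∃ p : F[X], aeval T p = g := by
  obtain ⟨v, hv⟩ := exists_forall_exists_aeval_mulVec_eq hT
  obtain ⟨p, hp⟩ := hv (g *ᵥ v)
  refine ⟨p, ext_of_mulVec_single fun i ↦ ?_⟩
  obtain ⟨q, hq⟩ := hv (Pi.single i 1)
  have hgq : g * aeval T q = aeval T q * g :=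
    Algebra.commute_of_mem_adjoin_singleton_of_commute (aeval_mem_adjoin_singleton F T) hg
  rw [← hq, mulVec_mulVec, mulVec_mulVec, ← map_mul, mul_comm, map_mul, hgq, ← mulVec_mulVec, hp,
    mulVec_mulVec]

open Polynomial in
theorem Matrix.transpose_aeval_mul_of_transpose_mul {F n : Type*} [Field F] [Fintype n]
    [DecidableEq n] {J T : Matrix n n F} (h : Tᵀ * J = J * T) (p : F[X]) :
    (aeval T p)ᵀ * J = J * aeval T p := by
  induction p using Polynomial.induction_on' with
  | add p q hp hq => simp [add_mul, mul_add, hp, hq]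
  | monomial k a =>
    have hk : (Tᵀ ^ k) * J = J * T ^ k :=
      (SemiconjBy.pow_right (a := J) (x := T) (y := Tᵀ) h.symm k).symm
    rw [aeval_monomial, ← Algebra.smul_def, transpose_smul, transpose_pow, smul_mul_assoc, hk,
      mul_smul_comm]

/-- **Stabilizer of a regular self-adjoint element in the orthogonal group.**
Let `F` be a field of characteristic `≠ 2`, `m ≥ 1`, `J` a symmetric
invertible `m × m` matrix, and `T` a regular self-adjoint matrix with
characteristic polynomial `f`; set `L = F[x]/(f)`. Then evaluation at `T`
descends to a well-defined (algebra, hence multiplicative) map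
`φ : L → M_m(F)` which is injective on `μ₂(L) = {u : L | u ^ 2 = 1}` and maps
`μ₂(L)` bijectively onto the stabilizer
`{g | gᵀ * J * g = J ∧ g * T = T * g}` of `T` in `O(J)(F)`. -/
theorem stabilizer_eq_mu2
    (F : Type) [Field F] (hF : ringChar F ≠ 2) (m : ℕ) (hm : 1 ≤ m)
    (J : Matrix (Fin m) (Fin m) F) (hJsymm : Jᵀ = J) (hJ : IsUnit J)
    (T : Matrix (Fin m) (Fin m) F)
    (hT : J⁻¹ * Tᵀ * J = T) (hTreg : minpoly F T = T.charpoly) :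
    ∃ φ : (Polynomial F ⧸ Ideal.span {T.charpoly}) →ₐ[F] Matrix (Fin m) (Fin m) F,
      (∀ p : Polynomial F,
        φ (Ideal.Quotient.mk (Ideal.span {T.charpoly}) p) = Polynomial.aeval T p) ∧
      Set.InjOn φ {u | u ^ 2 = 1} ∧
      φ '' {u | u ^ 2 = 1} = {g | gᵀ * J * g = J ∧ g * T = T * g} := by
  have hJdet : IsUnit J.det := (isUnit_iff_isUnit_det J).1 hJ
  have hTJ : Tᵀ * J = J * T := by
    conv_rhs => rw [← hT, mul_assoc J⁻¹, mul_nonsing_inv_cancel_left _ _ hJdet]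
  let φ : (Polynomial F ⧸ Ideal.span {T.charpoly}) →ₐ[F] Matrix (Fin m) (Fin m) F :=
    Ideal.Quotient.liftₐ _ (Polynomial.aeval T) fun p hp ↦ by
      obtain ⟨q, rfl⟩ := Ideal.mem_span_singleton.1 hp
      rw [map_mul, aeval_self_charpoly, zero_mul]
  have hφ (p : Polynomial F) :
      φ (Ideal.Quotient.mk (Ideal.span {T.charpoly}) p) = Polynomial.aeval T p := rfl
  have hinj : Function.Injective φ := by
    refine (injective_iff_map_eq_zero φ).2 fun u hu ↦ ?_
    obtain ⟨p, rfl⟩ := Ideal.Quotient.mk_surjective u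
    rw [Ideal.Quotient.eq_zero_iff_mem, Ideal.mem_span_singleton, ← hTreg]
    exact minpoly.dvd F T hu
  have hiso (p : Polynomial F) : (Polynomial.aeval T p)ᵀ * J * Polynomial.aeval T p = J ↔
      Polynomial.aeval T p ^ 2 = 1 := by
    rw [transpose_aeval_mul_of_transpose_mul hTJ, mul_assoc, ← pow_two, hJ.mul_eq_left]
  refine ⟨φ, hφ, hinj.injOn, Set.ext fun g ↦ ⟨?_, ?_⟩⟩
  · rintro ⟨u, hu, rfl⟩
    obtain ⟨p, rfl⟩ := Ideal.Quotient.mk_surjective u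
    refine ⟨(hiso p).2 ?_, ?_⟩
    · rw [← hφ, ← map_pow, hu, map_one]
    · exact (Algebra.commute_of_mem_adjoin_self
        (Polynomial.aeval_mem_adjoin_singleton F T)).symm.eq
  · rintro ⟨hg, hgT⟩
    obtain ⟨p, rfl⟩ := exists_aeval_eq_of_commute_s10 hTreg hgT
    refine ⟨Ideal.Quotient.mk _ p, hinj ?_, hφ p⟩
    rw [map_pow, hφ, map_one, (hiso p).1 hg]
end
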